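/- arXiv:math/0409205 — 3 statements merged into one kernel-verified Lean document; each statement's English description precedes it below -/
import Mathlib

section
/- (Garside) The positive braid monoid embeds in the braid group: the canonical monoid homomorphism B_n⁺ → B_n sending each generator σ_i to σ_i is injective; equivalently, two positive words in σ_1, …, σ_{n−1} represent the same element of B_n if and only if they represent the same element of B_n⁺. -/
/-- The set of relators for Artin's classical presentation of the braid group `Bₙ`:
generators `σ₁, …, σ_{n-1}` (indexed by `Fin (n-1)`), with relations
`σᵢ σₖ = σₖ σᵢ` when `|i - k| ≥ 2` and `σᵢ σ_{i+1} σᵢ = σ_{i+1} σᵢ σ_{i+1}`. -/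
def braidRels (n : ℕ) : Set (FreeGroup (Fin (n - 1))) :=
  {w | (∃ i k : Fin (n - 1), (i : ℕ) + 2 ≤ (k : ℕ) ∧
          w = FreeGroup.of i * FreeGroup.of k * (FreeGroup.of k * FreeGroup.of i)⁻¹) ∨
       (∃ i k : Fin (n - 1), (i : ℕ) + 1 = (k : ℕ) ∧
          w = FreeGroup.of i * FreeGroup.of k * FreeGroup.of i *
              (FreeGroup.of k * FreeGroup.of i * FreeGroup.of k)⁻¹)}

/-- The braid group `Bₙ`, given by Artin's classical presentation. -/
abbrev BraidGroup (n : ℕ) : Type := PresentedGroup (braidRels n)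

/-- The defining relations of the positive braid monoid `Bₙ⁺`:
`σᵢ σₖ = σₖ σᵢ` for `|i-k| ≥ 2` and `σᵢ σ_{i+1} σᵢ = σ_{i+1} σᵢ σ_{i+1}`,
as a relation on the free monoid on `σ₁, …, σ_{n-1}`. -/
inductive BraidMonoidRel (n : ℕ) :
    FreeMonoid (Fin (n - 1)) → FreeMonoid (Fin (n - 1)) → Prop
  | comm (i k : Fin (n - 1)) (h : (i : ℕ) + 2 ≤ (k : ℕ)) :
      BraidMonoidRel n (FreeMonoid.of i * FreeMonoid.of k)
        (FreeMonoid.of k * FreeMonoid.of i)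
  | braid (i k : Fin (n - 1)) (h : (i : ℕ) + 1 = (k : ℕ)) :
      BraidMonoidRel n (FreeMonoid.of i * FreeMonoid.of k * FreeMonoid.of i)
        (FreeMonoid.of k * FreeMonoid.of i * FreeMonoid.of k)

/-- The positive braid monoid `Bₙ⁺`: the quotient of the free monoid on
`σ₁, …, σ_{n-1}` by the monoid congruence generated by the braid relations. -/
abbrev BraidMonoid (n : ℕ) : Type := (conGen (BraidMonoidRel n)).Quotient

/-- The generator `σᵢ` of the positive braid monoid `Bₙ⁺`. -/
def braidMonoidGen (n : ℕ) (i : Fin (n - 1)) : BraidMonoid n :=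
  (conGen (BraidMonoidRel n)).mk' (FreeMonoid.of i)

namespace BraidMonoid

/-- Indices of generators that commute. -/
def Far {m : ℕ} (i k : Fin m) : Prop := (i : ℕ) + 2 ≤ k ∨ (k : ℕ) + 2 ≤ i

/-- Indices of generators that satisfy the braid relation. -/
def Adj {m : ℕ} (i k : Fin m) : Prop := (i : ℕ) + 1 = k ∨ (k : ℕ) + 1 = i

lemma Far.symm {m : ℕ} {i k : Fin m} (h : Far i k) : Far k i := Or.symm h

lemma Adj.symm {m : ℕ} {i k : Fin m} (h : Adj i k) : Adj k i := Or.symm h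

section Garside

variable {M : Type*} [Monoid M]

/-- The conclusion of Garside's lemma about an equality `s a * X = s b * Y`: it comes from the
least common multiple of `s a` and `s b`. -/
def LcmCond {m : ℕ} (s : Fin m → M) (a b : Fin m) (X Y : M) : Prop :=
  (a = b ∧ X = Y) ∨
  (Far a b ∧ ∃ Z, X = s b * Z ∧ Y = s a * Z) ∨
  (Adj a b ∧ ∃ Z, X = s b * (s a * Z) ∧ Y = s a * (s b * Z))

lemma LcmCond.symm {m : ℕ} {s : Fin m → M} {a b : Fin m} {X Y : M}
    (h : LcmCond s a b X Y) : LcmCond s b a Y X := by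
  rcases h with ⟨rfl, rfl⟩ | ⟨h, Z, hX, hY⟩ | ⟨h, Z, hX, hY⟩
  · exact Or.inl ⟨rfl, rfl⟩
  · exact Or.inr (Or.inl ⟨h.symm, Z, hY, hX⟩)
  · exact Or.inr (Or.inr ⟨h.symm, Z, hY, hX⟩)

lemma LcmCond.mul_right {m : ℕ} {s : Fin m → M} {a b : Fin m} {X Y : M}
    (h : LcmCond s a b X Y) (W : M) : LcmCond s a b (X * W) (Y * W) := by
  rcases h with ⟨rfl, rfl⟩ | ⟨h, Z, rfl, rfl⟩ | ⟨h, Z, rfl, rfl⟩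
  · exact Or.inl ⟨rfl, rfl⟩
  · exact Or.inr (Or.inl ⟨h, Z * W, by simp only [mul_assoc], by simp only [mul_assoc]⟩)
  · exact Or.inr (Or.inr ⟨h, Z * W, by simp only [mul_assoc], by simp only [mul_assoc]⟩)

variable {m : ℕ} {s : Fin m → M} {len : M → ℕ} {L : ℕ}

lemma LcmCond.trans_adj_far
    (hfar : ∀ a b, Far a b → ∀ x, s a * (s b * x) = s b * (s a * x))
    (hadj : ∀ a b, Adj a b → ∀ x, s a * (s b * (s a * x)) = s b * (s a * (s b * x)))
    (hlen : ∀ a x, len (s a * x) = len x + 1)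
    (H : ∀ a b X Y, len X < L → s a * X = s b * Y → LcmCond s a b X Y)
    {a c b : Fin m} {U V W : M} (hU : len U ≤ L)
    (hac : Adj a c ∧ ∃ Z, U = s c * (s a * Z) ∧ V = s a * (s c * Z))
    (hcb : Far c b ∧ ∃ Z, V = s b * Z ∧ W = s c * Z) : LcmCond s a b U W := by
  obtain ⟨hac, z₁, rfl, rfl⟩ := hac
  obtain ⟨hcb, z₂, hV, rfl⟩ := hcb
  simp only [hlen] at hU
  rcases H a b _ _ (by simp only [hlen]; omega) hV with
    ⟨rfl, -⟩ | ⟨hab, z, hz₁, rfl⟩ | ⟨hab, z, hz₁, rfl⟩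
  · simp only [Far, Adj] at hac hcb; omega
  · rcases H c b _ _ (by omega) hz₁ with ⟨rfl, -⟩ | ⟨-, z', rfl, rfl⟩ | ⟨h, -⟩
    · simp only [Far] at hcb; omega
    · refine Or.inr (Or.inl ⟨hab, s c * (s a * z'), ?_, ?_⟩)
      · rw [hfar a b hab, hfar c b hcb]
      · rw [hadj a c hac]
    · simp only [Far, Adj] at h hcb; omega
  · rcases H c b _ _ (by omega) hz₁ with ⟨rfl, -⟩ | ⟨-, z', rfl, hz⟩ | ⟨h, -⟩
    · simp only [Far] at hcb; omega
    · have := congrArg len hz₁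
      have := congrArg len hz
      simp only [hlen] at *
      rcases H a c _ _ (by omega) hz with ⟨rfl, -⟩ | ⟨h, -⟩ | ⟨-, y, rfl, rfl⟩
      · simp only [Adj] at hac; omega
      · simp only [Far, Adj] at h hac; omega
      · refine Or.inr (Or.inr ⟨hab, s c * (s a * (s b * y)), ?_, ?_⟩)
        · rw [hadj a b hab, hfar c b hcb, ← hfar c b hcb y, hadj a c hac]
        · rw [← hfar c b hcb, hadj c a hac.symm, hadj a b hab, hfar c b hcb]
    · simp only [Far, Adj] at h hcb; omega

/-- The amalgamation step of Garside's lemma. -/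
lemma LcmCond.trans
    (hfar : ∀ a b, Far a b → ∀ x, s a * (s b * x) = s b * (s a * x))
    (hadj : ∀ a b, Adj a b → ∀ x, s a * (s b * (s a * x)) = s b * (s a * (s b * x)))
    (hlen : ∀ a x, len (s a * x) = len x + 1)
    (H : ∀ a b X Y, len X < L → s a * X = s b * Y → LcmCond s a b X Y)
    {a c b : Fin m} {U V W : M} (hU : len U ≤ L) (hW : len W ≤ L)
    (hac : LcmCond s a c U V) (hcb : LcmCond s c b V W) : LcmCond s a b U W := by
  rcases hac with ⟨rfl, rfl⟩ | hac | hac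
  · exact hcb
  · rcases hcb with ⟨rfl, rfl⟩ | hcb | hcb
    · exact Or.inr (Or.inl hac)
    · obtain ⟨hac, z₁, rfl, rfl⟩ := hac
      obtain ⟨hcb, z₂, hV, rfl⟩ := hcb
      simp only [hlen] at hU
      rcases H a b _ _ (by omega) hV with ⟨rfl, rfl⟩ | ⟨hab, z, rfl, rfl⟩ | ⟨hab, z, rfl, rfl⟩
      · exact Or.inl ⟨rfl, rfl⟩
      · refine Or.inr (Or.inl ⟨hab, s c * z, ?_, ?_⟩)
        · rw [hfar c b hcb]
        · rw [hfar a c hac]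
      · refine Or.inr (Or.inr ⟨hab, s c * z, ?_, ?_⟩)
        · rw [hfar c b hcb, hfar a c hac]
        · rw [hfar c a hac.symm, hfar c b hcb]
    · obtain ⟨hac, z₁, hU', hV₁⟩ := hac
      obtain ⟨hcb, z₂, hV₂, hW'⟩ := hcb
      exact (trans_adj_far hfar hadj hlen H hW ⟨hcb.symm, z₂, hW', hV₂⟩
        ⟨hac.symm, z₁, hV₁, hU'⟩).symm
  · rcases hcb with ⟨rfl, rfl⟩ | hcb | hcb
    · exact Or.inr (Or.inr hac)
    · exact trans_adj_far hfar hadj hlen H hU hac hcb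
    · obtain ⟨hac, z₁, rfl, rfl⟩ := hac
      obtain ⟨hcb, z₂, hV, rfl⟩ := hcb
      simp only [hlen] at hU hW
      rcases H a b _ _ (by simp only [hlen]; omega) hV with
        ⟨rfl, h⟩ | ⟨hab, z, hz₁, hz₂⟩ | ⟨hab, -⟩
      · rcases H c c _ _ (by omega) h with ⟨-, rfl⟩ | ⟨h, -⟩ | ⟨h, -⟩
        · exact Or.inl ⟨rfl, rfl⟩
        · simp only [Far] at h; omega
        · simp only [Adj] at h; omega
      · rcases H c b _ _ (by omega) hz₁ with ⟨rfl, -⟩ | ⟨h, -⟩ | ⟨-, x, rfl, rfl⟩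
        · simp only [Adj] at hcb; omega
        · simp only [Far, Adj] at h hcb; omega
        rcases H c a _ _ (by omega) hz₂ with ⟨rfl, -⟩ | ⟨h, -⟩ | ⟨-, y, rfl, hz⟩
        · simp only [Adj] at hac; omega
        · simp only [Far, Adj] at h hac; omega
        simp only [hlen] at hU hW
        have hxy : s b * x = s a * y := by
          rcases H c c _ _ (by simp only [hlen]; omega) hz with ⟨-, h⟩ | ⟨h, -⟩ | ⟨h, -⟩
          · exact h
          · simp only [Far] at h; omega
          · simp only [Adj] at h; omega
        rcases H b a _ _ (by omega) hxy with ⟨rfl, -⟩ | ⟨-, t, rfl, rfl⟩ | ⟨h, -⟩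
        · simp only [Far] at hab; omega
        · refine Or.inr (Or.inl ⟨hab, s c * (s b * (s a * (s c * t))), ?_, ?_⟩)
          · rw [hfar a b hab, hadj a c hac, hadj c b hcb]
          · rw [hfar b a hab.symm, hadj b c hcb.symm, hadj c a hac.symm, hfar a b hab]
        · simp only [Far, Adj] at h hab; omega
      · simp only [Adj] at hab hac hcb; omega

lemma commute_prod_range (s : ℕ → M) (hfar : ∀ i k, i + 2 ≤ k → s i * s k = s k * s i)
    (k j : ℕ) (hkj : k < j) :
    ((List.range k).map s).prod * s j = s j * ((List.range k).map s).prod := by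
  induction k with
  | zero => simp
  | succ k ih =>
    simp only [List.range_succ, List.map_append, List.prod_append, List.map_cons, List.map_nil,
      List.prod_singleton]
    rw [mul_assoc, hfar k j (by omega), ← mul_assoc, ih (by omega), mul_assoc]

/-- In a monoid with braid relations, initial products of the generators shift indices. -/
lemma prod_range_mul_shift {m : ℕ} (s : ℕ → M)
    (hfar : ∀ i k, i + 2 ≤ k → s i * s k = s k * s i)
    (hadj : ∀ i, i + 1 < m → s i * s (i + 1) * s i = s (i + 1) * s i * s (i + 1))
    (k : ℕ) (hk : k ≤ m) (i : ℕ) (hi : i + 1 < k) :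
    ((List.range k).map s).prod * s i = s (i + 1) * ((List.range k).map s).prod := by
  induction k with
  | zero => omega
  | succ k ih =>
    rcases Nat.lt_or_ge (i + 1) k with h | h
    · simp only [List.range_succ, List.map_append, List.prod_append, List.map_cons, List.map_nil,
        List.prod_singleton]
      rw [mul_assoc, ← hfar i k (by omega), ← mul_assoc, ih (by omega) h, mul_assoc]
    · obtain rfl : k = i + 1 := by omega
      simp only [List.range_succ, List.map_append, List.prod_append, List.map_cons, List.map_nil,
        List.prod_singleton]
      rw [mul_assoc, mul_assoc, ← mul_assoc (s i), hadj i (by omega), ← mul_assoc, ← mul_assoc,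
        commute_prod_range s hfar i (i + 1) (by omega)]
      simp only [mul_assoc]

/-- A monoid with braid relations has a central element that is a multiple of all generators. -/
lemma exists_central_multiple {m : ℕ} (s : ℕ → M)
    (hfar : ∀ i k, i + 2 ≤ k → s i * s k = s k * s i)
    (hadj : ∀ i, i + 1 < m → s i * s (i + 1) * s i = s (i + 1) * s i * s (i + 1)) :
    ∃ C : M, (∀ i < m, C * s i = s i * C) ∧ ∀ i < m, ∃ t, s i * t = C := by
  rcases m with _ | m
  · exact ⟨1, by simp, by simp⟩
  have hshift := prod_range_mul_shift s hfar hadj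
  set A : ℕ → M := fun k => ((List.range k).map s).prod with hA
  have hsucc : ∀ k, A (k + 1) = A k * s k := fun k => by simp [hA, List.range_succ]
  have htail : ∀ k, ∃ B, A (k + 1) = s 0 * B ∧ (k ≤ m → A (m + 1) * A k = B * A (m + 1)) := by
    intro k
    induction k with
    | zero => exact ⟨1, by simp [hA], by simp [hA]⟩
    | succ k ih =>
      obtain ⟨B, hB, hB'⟩ := ih
      refine ⟨B * s (k + 1), by rw [hsucc, hB, mul_assoc], fun hk => ?_⟩
      rw [hsucc k, ← mul_assoc, hB' (by omega), mul_assoc, hshift (m + 1) le_rfl k (by omega),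
        mul_assoc]
  set δ := A (m + 1)
  have hpow : ∀ j i, i + j ≤ m → δ ^ j * s i = s (i + j) * δ ^ j := by
    intro j
    induction j with
    | zero => simp
    | succ j ih =>
      intro i hij
      rw [pow_succ', mul_assoc, ih i (by omega), ← mul_assoc,
        hshift (m + 1) le_rfl (i + j) (by omega), mul_assoc, add_assoc]
  obtain ⟨R, hR, hR'⟩ := htail m
  have hlast : δ ^ 2 * s m = s 0 * δ ^ 2 := by
    calc δ ^ 2 * s m = s 0 * R * δ * s m := by rw [pow_two, ← hR]
      _ = s 0 * (δ * (A m * s m)) := by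
        rw [mul_assoc (s 0), ← hR' le_rfl]; simp only [mul_assoc]
      _ = s 0 * δ ^ 2 := by rw [← hsucc, pow_two]
  refine ⟨δ ^ (m + 2), fun i hi => ?_, fun i hi => ?_⟩
  · have h₁ : δ ^ (m - i) * s i = s m * δ ^ (m - i) := by
      simpa [show i + (m - i) = m by omega] using hpow (m - i) i (by omega)
    have h₂ : δ ^ i * s 0 = s i * δ ^ i := by simpa using hpow i 0 (by omega)
    rw [show m + 2 = i + 2 + (m - i) by omega, pow_add, mul_assoc, h₁, pow_add, mul_assoc,
      ← mul_assoc (δ ^ 2), hlast, mul_assoc (s 0), ← mul_assoc (δ ^ i), h₂]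
    simp only [mul_assoc]
  · have h₂ : δ ^ i * s 0 = s i * δ ^ i := by simpa using hpow i 0 (by omega)
    refine ⟨δ ^ i * R * δ ^ (m + 1 - i), ?_⟩
    rw [← mul_assoc, ← mul_assoc, ← h₂, mul_assoc (δ ^ i), ← hR, mul_assoc, ← pow_succ',
      ← pow_add]
    congr 1
    omega

end Garside

section Presentation

variable {n : ℕ}

lemma far_comm {i k : Fin (n - 1)} (h : Far i k) :
    braidMonoidGen n i * braidMonoidGen n k = braidMonoidGen n k * braidMonoidGen n i := by
  have key : ∀ i k : Fin (n - 1), (i : ℕ) + 2 ≤ k →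
      braidMonoidGen n i * braidMonoidGen n k = braidMonoidGen n k * braidMonoidGen n i :=
    fun i k h => (Con.eq _).2 (ConGen.Rel.of _ _ (BraidMonoidRel.comm i k h))
  exact h.elim (key i k) fun h => (key k i h).symm

lemma adj_braid {i k : Fin (n - 1)} (h : Adj i k) :
    braidMonoidGen n i * braidMonoidGen n k * braidMonoidGen n i =
      braidMonoidGen n k * braidMonoidGen n i * braidMonoidGen n k := by
  have key : ∀ i k : Fin (n - 1), (i : ℕ) + 1 = k →
      braidMonoidGen n i * braidMonoidGen n k * braidMonoidGen n i =
        braidMonoidGen n k * braidMonoidGen n i * braidMonoidGen n k :=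
    fun i k h => (Con.eq _).2 (ConGen.Rel.of _ _ (BraidMonoidRel.braid i k h))
  exact h.elim (key i k) fun h => (key k i h).symm

/-- The word length on the positive braid monoid. -/
def length (n : ℕ) : BraidMonoid n →* Multiplicative ℕ :=
  (conGen (BraidMonoidRel n)).lift (FreeMonoid.lift fun _ => Multiplicative.ofAdd 1) <| by
    rw [Con.conGen_le]
    rintro _ _ (⟨i, k, h⟩ | ⟨i, k, h⟩) <;> simp [Con.ker_rel]

lemma length_gen_mul (i : Fin (n - 1)) (x : BraidMonoid n) :
    (length n (braidMonoidGen n i * x)).toAdd = (length n x).toAdd + 1 := by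
  rw [map_mul, add_comm]; rfl

lemma gen_induction {p : BraidMonoid n → Prop} (one : p 1)
    (gen_mul : ∀ i x, p x → p (braidMonoidGen n i * x)) (x : BraidMonoid n) : p x := by
  obtain ⟨w, rfl⟩ := Con.mk'_surjective x
  induction w using FreeMonoid.recOn with
  | one => exact one
  | of_mul i w hw => exact gen_mul i _ hw

/-- The relation between two words asserted by Garside's lemma. -/
def WordCond (n : ℕ) : List (Fin (n - 1)) → List (Fin (n - 1)) → Prop
  | [], [] => True
  | a :: u, b :: v => LcmCond (braidMonoidGen n) a b
      ((conGen (BraidMonoidRel n)).mk' (FreeMonoid.ofList u))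
      ((conGen (BraidMonoidRel n)).mk' (FreeMonoid.ofList v))
  | _, _ => False

/-- **Garside's lemma**. -/
lemma lcmCond_of_gen_mul_eq (a b : Fin (n - 1)) (X Y : BraidMonoid n)
    (h : braidMonoidGen n a * X = braidMonoidGen n b * Y) :
    LcmCond (braidMonoidGen n) a b X Y := by
  induction hL : (length n X).toAdd using Nat.strong_induction_on generalizing a b X Y with
  | _ L IH =>
  obtain ⟨u, rfl⟩ := Con.mk'_surjective X
  obtain ⟨v, rfl⟩ := Con.mk'_surjective Y
  have hrel : ConGen.Rel (BraidMonoidRel n) (FreeMonoid.of a * u) (FreeMonoid.of b * v) :=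
    (Con.eq _).1 h
  have hlen : ∀ w : FreeMonoid (Fin (n - 1)),
      (length n ((conGen (BraidMonoidRel n)).mk' w)).toAdd = w.length := by
    intro w
    induction w using FreeMonoid.recOn with
    | one => rfl
    | of_mul i w hw =>
      rw [map_mul, FreeMonoid.length_mul, ← hw]
      exact (length_gen_mul i _).trans (add_comm _ _)
  have hlen' : ∀ u v : FreeMonoid (Fin (n - 1)), ConGen.Rel (BraidMonoidRel n) u v →
      u.length = v.length := by
    intro u v huv
    have heq : (conGen (BraidMonoidRel n)).mk' u = (conGen (BraidMonoidRel n)).mk' v :=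
      (Con.eq _).2 huv
    rw [← hlen, ← hlen, heq]
  have key : ∀ u v : FreeMonoid (Fin (n - 1)), ConGen.Rel (BraidMonoidRel n) u v →
      u.length ≤ L + 1 → WordCond n u.toList v.toList := by
    intro u v huv
    induction huv with
    | of u v h =>
      intro _
      rcases h with ⟨i, k, h⟩ | ⟨i, k, h⟩
      · exact Or.inr (Or.inl ⟨Or.inl h, 1, rfl, rfl⟩)
      · exact Or.inr (Or.inr ⟨Or.inl h, 1, rfl, rfl⟩)
    | refl u =>
      intro _
      rcases u with _ | ⟨a, u⟩
      · trivial
      · exact Or.inl ⟨rfl, rfl⟩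
    | @symm u v huv ih =>
      intro hu
      have := ih ((hlen' _ _ huv).trans_le hu)
      rcases u with _ | ⟨a, u⟩ <;> rcases v with _ | ⟨b, v⟩
      · trivial
      · exact this
      · exact this
      · exact LcmCond.symm this
    | @trans u v w huv hvw ih₁ ih₂ =>
      intro hu
      have h₁ := ih₁ hu
      have h₂ := ih₂ ((hlen' _ _ huv).symm.trans_le hu)
      have hw := ((hlen' _ _ huv).trans (hlen' _ _ hvw)).symm.trans_le hu
      rcases u with _ | ⟨a, u⟩ <;> rcases v with _ | ⟨c, v⟩ <;> rcases w with _ | ⟨b, w⟩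
      · trivial
      · exact h₂
      · trivial
      · exact h₁.elim
      · exact h₁
      · exact h₁.elim
      · exact h₂
      · refine LcmCond.trans (len := fun x => (length n x).toAdd) (L := L) ?_ ?_ length_gen_mul
          (fun a b X Y hX h => IH _ hX a b X Y h rfl) ?_ ?_ h₁ h₂
        · intro a b hab x
          rw [← mul_assoc, far_comm hab, mul_assoc]
        · intro a b hab x
          have := congrArg (· * x) (adj_braid hab)
          simpa only [mul_assoc] using this
        · exact (hlen u).trans_le (Nat.le_of_succ_le_succ hu)
        · exact (hlen w).trans_le (Nat.le_of_succ_le_succ hw)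
    | @mul u v u' v' huv huv' ih₁ ih₂ =>
      intro hu
      rw [FreeMonoid.length_mul] at hu
      have h₁ := ih₁ (by omega)
      have h₂ := ih₂ (by omega)
      have heq := (Con.eq (conGen (BraidMonoidRel n))).2 huv'
      rcases u with _ | ⟨a, u⟩ <;> rcases v with _ | ⟨b, v⟩
      · exact h₂
      · exact h₁.elim
      · exact h₁.elim
      · have := LcmCond.mul_right h₁ ((conGen (BraidMonoidRel n)).mk' u')
        nth_rw 2 [show (conGen (BraidMonoidRel n)).mk' u' = (conGen (BraidMonoidRel n)).mk' v'
          from heq] at this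
        exact this
  refine key _ _ hrel ?_
  rw [FreeMonoid.length_mul, ← hL, hlen, FreeMonoid.length_of, add_comm]

lemma gen_mul_left_cancel (a : Fin (n - 1)) {X Y : BraidMonoid n}
    (h : braidMonoidGen n a * X = braidMonoidGen n a * Y) : X = Y := by
  rcases lcmCond_of_gen_mul_eq a a X Y h with ⟨-, h⟩ | ⟨h, -⟩ | ⟨h, -⟩
  · exact h
  · simp only [Far] at h; omega
  · simp only [Adj] at h; omega

lemma left_cancel (W : BraidMonoid n) {X Y : BraidMonoid n} (h : W * X = W * Y) : X = Y := by
  induction W using gen_induction with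
  | one => simpa using h
  | gen_mul i W ih => exact ih (gen_mul_left_cancel i (by simpa only [mul_assoc] using h))

lemma exists_central_mul_eq (n : ℕ) (X : BraidMonoid n) :
    ∃ C t : BraidMonoid n, (∀ Y, C * Y = Y * C) ∧ t * X = C ∧ X * t = C := by
  obtain ⟨C, hC, hdvd⟩ := exists_central_multiple (m := n - 1)
    (fun i => if h : i < n - 1 then braidMonoidGen n ⟨i, h⟩ else 1) (by
      intro i k hik
      split_ifs
      · exact far_comm (Or.inl hik)
      all_goals simp) (by
      intro i hi
      rw [dif_pos hi, dif_pos (by omega : i < n - 1)]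
      exact adj_braid (Or.inl rfl))
  have hcen : ∀ Y, C * Y = Y * C := by
    intro Y
    induction Y using gen_induction with
    | one => simp
    | gen_mul i Y ih =>
      have := hC i i.2
      simp only [i.2, dif_pos] at this
      rw [← mul_assoc, this, mul_assoc, ih, mul_assoc]
  suffices ∃ D t : BraidMonoid n, (∀ Y, D * Y = Y * D) ∧ X * t = D by
    obtain ⟨D, t, hD, h⟩ := this
    refine ⟨D, t, hD, left_cancel X ?_, h⟩
    rw [← mul_assoc, h, hD]
  induction X using gen_induction with
  | one => exact ⟨1, 1, by simp, by simp⟩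
  | gen_mul i X ih =>
    obtain ⟨D, t, hD, h⟩ := ih
    obtain ⟨r, hr⟩ := hdvd i i.2
    simp only [i.2, dif_pos] at hr
    refine ⟨D * C, t * r, fun Y => ?_, ?_⟩
    · rw [mul_assoc, hcen, ← mul_assoc, hD, mul_assoc]
    · rw [mul_assoc, ← mul_assoc X, h, hD, ← mul_assoc, hr, hD]

/-- The canonical homomorphism from the positive braid monoid to the braid group. -/
def toBraidGroup (n : ℕ) : BraidMonoid n →* BraidGroup n :=
  (conGen (BraidMonoidRel n)).lift (FreeMonoid.lift PresentedGroup.of) <| by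
    rw [Con.conGen_le]
    rintro _ _ (⟨i, k, h⟩ | ⟨i, k, h⟩)
    · exact PresentedGroup.mk_eq_mk_of_mul_inv_mem (Or.inl ⟨i, k, h, rfl⟩)
    · exact PresentedGroup.mk_eq_mk_of_mul_inv_mem (Or.inr ⟨i, k, h, rfl⟩)

lemma toBraidGroup_gen (i : Fin (n - 1)) :
    toBraidGroup n (braidMonoidGen n i) = PresentedGroup.of i := rfl

/-- All elements of the positive braid monoid form a left Ore set. -/
noncomputable instance : OreLocalization.OreSet (⊤ : Submonoid (BraidMonoid n)) where
  ore_right_cancel r₁ r₂ s h := by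
    obtain ⟨C, t, hC, -, hst⟩ := exists_central_mul_eq n s
    refine ⟨⟨C, trivial⟩, ?_⟩
    change C * r₁ = C * r₂
    rw [hC, hC, ← hst, ← mul_assoc, h, mul_assoc]
  oreNum r s := r * (exists_central_mul_eq n s).choose_spec.choose
  oreDenom _ s := ⟨(exists_central_mul_eq n s).choose, trivial⟩
  ore_eq r s := by
    obtain ⟨hC, h, -⟩ := (exists_central_mul_eq n s).choose_spec.choose_spec
    rw [mul_assoc, h, hC]

/-- The map from the positive braid monoid to the units of its localization at all elements. -/
noncomputable def toUnits (n : ℕ) :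
    BraidMonoid n →* (OreLocalization (⊤ : Submonoid (BraidMonoid n)) (BraidMonoid n))ˣ :=
  IsUnit.liftRight OreLocalization.numeratorHom fun x =>
    OreLocalization.numerator_isUnit (⟨x, trivial⟩ : (⊤ : Submonoid (BraidMonoid n)))

lemma toUnits_injective (n : ℕ) : Function.Injective (toUnits n) := by
  intro x y h
  have h' : (OreLocalization.numeratorHom x :
      OreLocalization (⊤ : Submonoid (BraidMonoid n)) (BraidMonoid n)) =
        OreLocalization.numeratorHom y := congrArg Units.val h
  rw [OreLocalization.numeratorHom_apply, OreLocalization.numeratorHom_apply,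
    OreLocalization.oreDiv_eq_iff] at h'
  obtain ⟨u, v, h₁, h₂⟩ := h'
  obtain rfl : (u : BraidMonoid n) = v := by simpa using h₂
  exact (left_cancel _ h₁).symm

lemma toBraidGroup_injective (n : ℕ) : Function.Injective (toBraidGroup n) := by
  have hrel : ∀ r ∈ braidRels n,
      FreeGroup.lift (fun i => toUnits n (braidMonoidGen n i)) r = 1 := by
    rintro _ (⟨i, k, h, rfl⟩ | ⟨i, k, h, rfl⟩)
    · simp only [map_mul, map_inv, FreeGroup.lift_apply_of, mul_inv_eq_one]
      simp only [← map_mul, far_comm (Or.inl h)]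
    · simp only [map_mul, map_inv, FreeGroup.lift_apply_of, mul_inv_eq_one]
      simp only [← map_mul, adj_braid (Or.inl h)]
  have hcomp : ∀ x, PresentedGroup.toGroup hrel (toBraidGroup n x) = toUnits n x := by
    intro x
    induction x using gen_induction with
    | one => simp
    | gen_mul i x ih =>
      rw [map_mul, map_mul, map_mul, ih, toBraidGroup_gen, PresentedGroup.toGroup.of]
  intro x y h
  apply toUnits_injective n
  rw [← hcomp, ← hcomp, h]

end Presentation

end BraidMonoid

/-- (Garside) The positive braid monoid embeds in the braid group: the canonical
monoid homomorphism `Bₙ⁺ → Bₙ` sending `σᵢ ↦ σᵢ` is (well defined and) injective;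
equivalently, two positive words in `σ₁, …, σ_{n-1}` represent the same element of `Bₙ`
if and only if they represent the same element of `Bₙ⁺`. -/
theorem positive_braid_monoid_embeds (n : ℕ) :
    (∃ f : BraidMonoid n →* BraidGroup n,
        (∀ i : Fin (n - 1), f (braidMonoidGen n i) = PresentedGroup.of i) ∧
        Function.Injective f) ∧
    (∀ u v : FreeMonoid (Fin (n - 1)),
        FreeMonoid.lift (fun i => (PresentedGroup.of i : BraidGroup n)) u =
          FreeMonoid.lift (fun i => (PresentedGroup.of i : BraidGroup n)) v ↔
        (conGen (BraidMonoidRel n)).mk' u = (conGen (BraidMonoidRel n)).mk' v) := by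
  have hword : ∀ u, FreeMonoid.lift (fun i => (PresentedGroup.of i : BraidGroup n)) u =
      BraidMonoid.toBraidGroup n ((conGen (BraidMonoidRel n)).mk' u) := fun _ => rfl
  refine ⟨⟨BraidMonoid.toBraidGroup n, BraidMonoid.toBraidGroup_gen,
    BraidMonoid.toBraidGroup_injective n⟩, fun u v => ?_⟩
  rw [hword, hword, (BraidMonoid.toBraidGroup_injective n).eq_iff]
end

section
/- Every element of the braid group B_n can be written as a power of the Garside element times a positive braid: for every x ∈ B_n there exist an integer r ∈ ℤ and an element p in the image of the canonical monoid homomorphism B_n⁺ → B_n such that x = Δ_n^r · p. -/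
/-- The generator `σ_{i+1}` of `Bₙ` for a natural-number index `i < n - 1`
(junk value `1` otherwise). -/
def sigmaB (n : ℕ) (i : ℕ) : BraidGroup n :=
  if h : i < n - 1 then PresentedGroup.of (⟨i, h⟩ : Fin (n - 1)) else 1

/-- The Garside element
`Δₙ = (σ_{n-1} ⋯ σ₁)(σ_{n-1} ⋯ σ₂) ⋯ (σ_{n-1} σ_{n-2})(σ_{n-1}) ∈ Bₙ`
(written with the 0-indexed Lean generators `x_j = σ_{j+1}`). -/
def deltaB (n : ℕ) : BraidGroup n :=
  ((List.range (n - 1)).map fun k =>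
    ((List.range (n - 1 - k)).map fun j => sigmaB n (n - 2 - j)).prod).prod

section ArtinSequence

variable {G : Type*} [Group G]

/-- The ascending product `t₀ t₁ ⋯ t_{k-1}`. -/
def ascProd (t : ℕ → G) (k : ℕ) : G := ((List.range k).map t).prod

/-- The product `(t₀ ⋯ t_{k-1})(t₀ ⋯ t_{k-2}) ⋯ (t₀)`. -/
def garsideProd (t : ℕ → G) (k : ℕ) : G := ((List.range k).map fun i => ascProd t (k - i)).prod

theorem ascProd_succ (t : ℕ → G) (k : ℕ) : ascProd t (k + 1) = ascProd t k * t k :=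
  List.prod_range_succ t k

theorem ascProd_succ' (t : ℕ → G) (k : ℕ) :
    ascProd t (k + 1) = t 0 * ascProd (fun i => t (i + 1)) k :=
  List.prod_range_succ' t k

theorem garsideProd_succ (t : ℕ → G) (k : ℕ) :
    garsideProd t (k + 1) = ascProd t (k + 1) * garsideProd t k := by
  simp only [garsideProd, List.prod_range_succ', Nat.sub_zero,
    Nat.succ_eq_add_one, Nat.add_sub_add_right]

/-- The elements `t₀, …, t_{m-1}` satisfy the Artin relations. -/
structure IsArtinSeq (t : ℕ → G) (m : ℕ) : Prop where
  comm : ∀ i j, i + 2 ≤ j → j < m → t i * t j = t j * t i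
  braid : ∀ i, i + 1 < m → t i * t (i + 1) * t i = t (i + 1) * t i * t (i + 1)

theorem ascProd_mem {t : ℕ → G} {S : Submonoid G} {k : ℕ} (h : ∀ i < k, t i ∈ S) :
    ascProd t k ∈ S :=
  S.list_prod_mem (by simpa using h)

theorem garsideProd_mem {t : ℕ → G} {S : Submonoid G} {k : ℕ} (h : ∀ i < k, t i ∈ S) :
    garsideProd t k ∈ S := by
  refine S.list_prod_mem ?_
  simp only [List.mem_map, List.mem_range]
  rintro _ ⟨i, -, rfl⟩
  exact ascProd_mem fun j hj => h j (by omega)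

namespace IsArtinSeq

variable {t : ℕ → G} {m : ℕ}

theorem ascProd_mul (ht : IsArtinSeq t m) {j k : ℕ} (hjk : k + 1 ≤ j) (hj : j < m) :
    ascProd t k * t j = t j * ascProd t k := by
  have h : ascProd t k ∈ Submonoid.centralizer {t j} := ascProd_mem fun i hi =>
    Submonoid.mem_centralizer_iff.2 fun g hg => by
      rw [Set.mem_singleton_iff.1 hg, ht.comm i j (by omega) hj]
  exact (Submonoid.mem_centralizer_iff.1 h _ rfl).symm

theorem garsideProd_mul (ht : IsArtinSeq t m) {j k : ℕ} (hjk : k + 1 ≤ j) (hj : j < m) :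
    garsideProd t k * t j = t j * garsideProd t k := by
  have h : garsideProd t k ∈ Submonoid.centralizer {t j} := garsideProd_mem fun i hi =>
    Submonoid.mem_centralizer_iff.2 fun g hg => by
      rw [Set.mem_singleton_iff.1 hg, ht.comm i j (by omega) hj]
  exact (Submonoid.mem_centralizer_iff.1 h _ rfl).symm

theorem ascProd_mul_shift (ht : IsArtinSeq t m) {i k : ℕ} (hik : i + 1 < k) (hk : k ≤ m) :
    ascProd t k * t i = t (i + 1) * ascProd t k := by
  induction k, hik using Nat.le_induction with
  | base =>
    have h := ht.ascProd_mul (le_refl (i + 1)) (by omega)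
    rw [ascProd_succ, ascProd_succ]
    calc ascProd t i * t i * t (i + 1) * t i
        = ascProd t i * (t i * t (i + 1) * t i) := by group
      _ = ascProd t i * t (i + 1) * (t i * t (i + 1)) := by rw [ht.braid i (by omega)]; group
      _ = _ := by rw [h]; group
  | succ k hik ih =>
    rw [ascProd_succ, mul_assoc, ← ht.comm i k (by omega) (by omega), ← mul_assoc,
      ih (by omega), mul_assoc]

theorem ascProd_mul_ascProd (ht : IsArtinSeq t m) {j k : ℕ} (hjk : j < k) (hk : k ≤ m) :
    ascProd t k * ascProd t j = ascProd (fun i => t (i + 1)) j * ascProd t k := by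
  induction j with
  | zero => simp [ascProd]
  | succ j ih =>
    rw [ascProd_succ, ascProd_succ, ← mul_assoc, ih (by omega), mul_assoc,
      ht.ascProd_mul_shift hjk hk, mul_assoc]

/-- Conjugation by the Garside product flips the generators. -/
theorem garsideProd_mul_flip (ht : IsArtinSeq t m) {i j k : ℕ} (hij : i + j + 1 = k)
    (hk : k ≤ m) : garsideProd t k * t i = t j * garsideProd t k := by
  induction k generalizing i j with
  | zero => omega
  | succ k ih =>
    rw [garsideProd_succ]
    obtain _ | j := j
    · obtain rfl : i = k := by omega
      obtain _ | i := i
      · simp [garsideProd, ascProd]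
      · rw [garsideProd_succ, mul_assoc, mul_assoc, ht.garsideProd_mul le_rfl (by omega),
          ← mul_assoc (ascProd t (i + 1)), ← ascProd_succ, ← mul_assoc (ascProd t (i + 1 + 1))]
        nth_rw 1 [ascProd_succ']
        rw [mul_assoc (t 0), ← ht.ascProd_mul_ascProd (Nat.lt_succ_self _) hk]
        simp only [mul_assoc]
    · rw [mul_assoc, ih (j := j) (by omega) (by omega), ← mul_assoc,
        ht.ascProd_mul_shift (by omega) hk, mul_assoc]

/-- Every generator is a right divisor of the Garside product among positive words. -/
theorem exists_garsideProd_eq_mul (ht : IsArtinSeq t m) {S : Submonoid G}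
    (hS : ∀ i < m, t i ∈ S) {i k : ℕ} (hik : i < k) (hk : k ≤ m) :
    ∃ q ∈ S, garsideProd t k = q * t i := by
  induction k with
  | zero => omega
  | succ k ih =>
    obtain h | rfl : i < k ∨ i = k := by omega
    · obtain ⟨q, hq, e⟩ := ih h (by omega)
      exact ⟨ascProd t (k + 1) * q, S.mul_mem (ascProd_mem fun j hj => hS j (by omega)) hq,
        by rw [garsideProd_succ, e, mul_assoc]⟩
    · refine ⟨ascProd (fun l => t (l + 1)) i * garsideProd t i,
        S.mul_mem (ascProd_mem fun j hj => hS _ (by omega))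
          (garsideProd_mem fun j hj => hS j (by omega)), mul_left_cancel (a := t 0) ?_⟩
      rw [← ht.garsideProd_mul_flip (i := i) (by omega) hk, ← mul_assoc, ← mul_assoc, ← ascProd_succ',
        ← garsideProd_succ]

end IsArtinSeq

end ArtinSequence

/-- If a set `T` generates a group and `d` normalizes the submonoid generated by `T` and is a left
multiple in it of each element of `T`, then every element is a power of `d` times a positive
element. -/
theorem exists_zpow_mul_mem_closure {G : Type*} [Group G] {T : Set G}
    (hT : Subgroup.closure T = ⊤) {d : G}
    (hconj : ∀ a ∈ T, d * a * d⁻¹ ∈ T) (hconj' : ∀ a ∈ T, d⁻¹ * a * d ∈ T)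
    (hdvd : ∀ a ∈ T, ∃ q ∈ Submonoid.closure T, d = q * a) (x : G) :
    ∃ (r : ℤ) (p : G), p ∈ Submonoid.closure T ∧ x = d ^ r * p := by
  have conj_mem : ∀ c : G, (∀ a ∈ T, c * a * c⁻¹ ∈ T) →
      ∀ p ∈ Submonoid.closure T, c * p * c⁻¹ ∈ Submonoid.closure T := by
    intro c hc p hp
    have : Submonoid.closure T ≤ (Submonoid.closure T).comap (MulAut.conj c).toMonoidHom :=
      Submonoid.closure_le.2 fun a ha => Submonoid.subset_closure (hc a ha)
    exact this hp
  have zpow_mem : ∀ (r : ℤ), ∀ p ∈ Submonoid.closure T,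
      d ^ (-r) * p * d ^ r ∈ Submonoid.closure T := by
    intro r
    induction r with
    | zero => simp
    | succ r ih =>
      intro p hp
      have h := conj_mem d⁻¹ (by simpa using hconj') _ (ih p hp)
      convert h using 1
      group
    | pred r ih =>
      intro p hp
      have h := conj_mem d hconj _ (ih p hp)
      convert h using 1
      group
  have hx : x ∈ Subgroup.closure T := hT ▸ Subgroup.mem_top x
  induction hx using Subgroup.closure_induction_left with
  | one => exact ⟨0, 1, one_mem _, by simp⟩
  | mul_left a ha y _ ih =>
    obtain ⟨r, p, hp, rfl⟩ := ih
    exact ⟨r, d ^ (-r) * a * d ^ r * p,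
      mul_mem (zpow_mem r a (Submonoid.subset_closure ha)) hp, by group⟩
  | inv_mul_cancel a ha y _ ih =>
    obtain ⟨r, p, hp, rfl⟩ := ih
    obtain ⟨q, hq, e⟩ := hdvd a ha
    refine ⟨r - 1, d ^ (-r) * q * d ^ r * p, mul_mem (zpow_mem r q hq) hp, ?_⟩
    have ea : a⁻¹ = d⁻¹ * q := by rw [e]; group
    rw [ea]
    group

/-- A group generated by an Artin sequence consists of powers of the Garside product times positive
elements. -/
theorem IsArtinSeq.exists_garsideProd_zpow_mul {G : Type*} [Group G] {t : ℕ → G} {m : ℕ}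
    (ht : IsArtinSeq t m) (hgen : Subgroup.closure (t '' Set.Iio m) = ⊤) (x : G) :
    ∃ (r : ℤ) (p : G), p ∈ Submonoid.closure (t '' Set.Iio m) ∧ x = garsideProd t m ^ r * p := by
  have hflip : ∀ i < m, m - 1 - i < m ∧
      garsideProd t m * t i = t (m - 1 - i) * garsideProd t m ∧
      garsideProd t m * t (m - 1 - i) = t i * garsideProd t m := fun i hi =>
    ⟨by omega, ht.garsideProd_mul_flip (by omega) le_rfl,
      ht.garsideProd_mul_flip (by omega) le_rfl⟩
  refine exists_zpow_mul_mem_closure hgen ?_ ?_ ?_ x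
  · rintro _ ⟨i, hi, rfl⟩
    obtain ⟨h, e, -⟩ := hflip i hi
    exact ⟨_, h, eq_mul_inv_of_mul_eq e.symm⟩
  · rintro _ ⟨i, hi, rfl⟩
    obtain ⟨h, -, e⟩ := hflip i hi
    exact ⟨_, h, by rw [mul_assoc, ← e, inv_mul_cancel_left]⟩
  · rintro _ ⟨i, hi, rfl⟩
    exact ht.exists_garsideProd_eq_mul
      (fun j hj => Submonoid.subset_closure (Set.mem_image_of_mem t hj)) hi le_rfl

theorem sigmaB_mul_comm {n i k : ℕ} (h : i + 2 ≤ k) (hk : k < n - 1) :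
    sigmaB n i * sigmaB n k = sigmaB n k * sigmaB n i := by
  have hi : i < n - 1 := by omega
  simp only [sigmaB, hi, hk, dif_pos]
  have := PresentedGroup.one_of_mem (rels := braidRels n) (Or.inl ⟨⟨i, hi⟩, ⟨k, hk⟩, h, rfl⟩)
  rw [map_mul, map_inv, mul_inv_eq_one, map_mul, map_mul] at this
  exact this

theorem sigmaB_braid {n i : ℕ} (h : i + 1 < n - 1) :
    sigmaB n i * sigmaB n (i + 1) * sigmaB n i =
      sigmaB n (i + 1) * sigmaB n i * sigmaB n (i + 1) := by
  have hi : i < n - 1 := by omega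
  simp only [sigmaB, hi, h, dif_pos]
  have := PresentedGroup.one_of_mem (rels := braidRels n)
    (Or.inr ⟨⟨i, hi⟩, ⟨i + 1, h⟩, rfl, rfl⟩)
  rw [map_mul, map_inv, mul_inv_eq_one] at this
  simp only [map_mul] at this
  exact this

theorem isArtinSeq_sigmaB (n : ℕ) : IsArtinSeq (fun i => sigmaB n (n - 2 - i)) (n - 1) where
  comm i j h hj := (sigmaB_mul_comm (by omega) (by omega)).symm
  braid i h := by
    have e : n - 2 - i = n - 2 - (i + 1) + 1 := by omega
    rw [e]
    exact (sigmaB_braid (by omega)).symm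

theorem deltaB_eq_garsideProd (n : ℕ) :
    deltaB n = garsideProd (fun i => sigmaB n (n - 2 - i)) (n - 1) := rfl

theorem range_of_eq_image_sigmaB (n : ℕ) :
    (Set.range fun i : Fin (n - 1) => (PresentedGroup.of i : BraidGroup n)) =
      (fun i => sigmaB n (n - 2 - i)) '' Set.Iio (n - 1) := by
  ext x
  constructor
  · rintro ⟨i, rfl⟩
    have hi := i.2
    refine ⟨n - 2 - i, Set.mem_Iio.2 (by omega), ?_⟩
    have e : n - 2 - (n - 2 - (i : ℕ)) = i := by omega
    simp only [e, sigmaB, hi, dif_pos]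
  · rintro ⟨i, hi, rfl⟩
    have hi' : n - 2 - i < n - 1 := by have := Set.mem_Iio.1 hi; omega
    exact ⟨⟨_, hi'⟩, by simp only [sigmaB, hi', dif_pos]⟩


/-- Every element of `Bₙ` is a power of the Garside element `Δₙ` times a positive braid,
i.e. times an element of the submonoid generated by `σ₁, …, σ_{n-1}` (which is exactly the
image of the canonical monoid homomorphism `Bₙ⁺ → Bₙ`). -/
theorem braid_delta_power_times_positive (n : ℕ) (x : BraidGroup n) :
    ∃ (r : ℤ) (p : BraidGroup n),
      p ∈ Submonoid.closure
        (Set.range fun i : Fin (n - 1) => (PresentedGroup.of i : BraidGroup n)) ∧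
      x = deltaB n ^ r * p := by
  have ht := isArtinSeq_sigmaB n
  have hgen : Subgroup.closure
      (Set.range fun i : Fin (n - 1) => (PresentedGroup.of i : BraidGroup n)) = ⊤ :=
    PresentedGroup.closure_range_of _
  rw [range_of_eq_image_sigmaB] at hgen ⊢
  rw [deltaB_eq_garsideProd]
  exact ht.exists_garsideProd_zpow_mul hgen x
end

section
/- (Birman–Ko–Lee) The Birman–Ko–Lee monoid embeds in the braid group: the monoid homomorphism from BKL_n⁺ to B_n sending each generator σ_{s,t} (1 ≤ s < t ≤ n) to the band word (σ_{t−1} σ_{t−2} ⋯ σ_{s+1}) σ_s (σ_{s+1}⁻¹ ⋯ σ_{t−1}⁻¹) is well defined and injective. -/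
/-- The band generator of `Bₙ` joining (0-indexed) strands `a < b`; in 1-indexed classical
notation, `σ_{s,t} = (σ_{t-1} ⋯ σ_{s+1}) σ_s (σ_{s+1}⁻¹ ⋯ σ_{t-1}⁻¹)` where `s = a+1`,
`t = b+1`.  Defined recursively: `band a (a+1) = σ_{a+1}` and
`band a (b+1) = σ_{b+1} · band a b · σ_{b+1}⁻¹`. -/
def bandWord (n a : ℕ) : ℕ → BraidGroup n
  | 0 => 1
  | b + 1 => if b = a then sigmaB n a else sigmaB n b * bandWord n a b * (sigmaB n b)⁻¹

/-- Index set for the Birman–Ko–Lee generators: pairs of strands `s < t` (0-indexed). -/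
abbrev BKLIdx (n : ℕ) : Type := {p : Fin n × Fin n // p.1 < p.2}
/-- The defining relations of the Birman–Ko–Lee monoid `BKLₙ⁺`:
`σ_{s,t} σ_{q,r} = σ_{q,r} σ_{s,t}` whenever `(t-r)(t-q)(s-r)(s-q) > 0`, and
`σ_{s,t} σ_{r,s} = σ_{r,t} σ_{s,t} = σ_{r,s} σ_{r,t}` whenever `r < s < t`. -/
inductive BKLMonoidRel (n : ℕ) :
    FreeMonoid (BKLIdx n) → FreeMonoid (BKLIdx n) → Prop
  | comm (p q : BKLIdx n)
      (h : (((p.1.2 : ℕ) : ℤ) - ((q.1.2 : ℕ) : ℤ)) *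
        (((p.1.2 : ℕ) : ℤ) - ((q.1.1 : ℕ) : ℤ)) *
        (((p.1.1 : ℕ) : ℤ) - ((q.1.2 : ℕ) : ℤ)) *
        (((p.1.1 : ℕ) : ℤ) - ((q.1.1 : ℕ) : ℤ)) > 0) :
      BKLMonoidRel n (FreeMonoid.of p * FreeMonoid.of q)
        (FreeMonoid.of q * FreeMonoid.of p)
  | triangleA (r s t : Fin n) (hrs : r < s) (hst : s < t) :
      BKLMonoidRel n (FreeMonoid.of ⟨(s, t), hst⟩ * FreeMonoid.of ⟨(r, s), hrs⟩)
        (FreeMonoid.of ⟨(r, t), hrs.trans hst⟩ * FreeMonoid.of ⟨(s, t), hst⟩)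
  | triangleB (r s t : Fin n) (hrs : r < s) (hst : s < t) :
      BKLMonoidRel n (FreeMonoid.of ⟨(s, t), hst⟩ * FreeMonoid.of ⟨(r, s), hrs⟩)
        (FreeMonoid.of ⟨(r, s), hrs⟩ * FreeMonoid.of ⟨(r, t), hrs.trans hst⟩)

/-- The Birman–Ko–Lee monoid `BKLₙ⁺`. -/
abbrev BKLMonoid (n : ℕ) : Type := (conGen (BKLMonoidRel n)).Quotient

namespace BKL

variable {n : ℕ}

/-- The half-open interval `(s, t]` attached to the generator `σ_{s,t}`. -/
def Side (p : BKLIdx n) (x : Fin n) : Prop := p.1.1 < x ∧ x ≤ p.1.2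

/-- The refinement of a partition obtained by cutting its blocks along `(s, t]`. -/
def cut (p : BKLIdx n) (S : Setoid (Fin n)) : Setoid (Fin n) where
  r x y := S x y ∧ (Side p x ↔ Side p y)
  iseqv :=
    ⟨fun x => ⟨S.refl x, Iff.rfl⟩, fun h => ⟨S.symm h.1, h.2.symm⟩,
      fun h k => ⟨S.trans h.1 k.1, h.2.trans k.2⟩⟩

/-- The coarsening of a partition obtained by merging the blocks of `s` and `t`. -/
def join (p : BKLIdx n) (S : Setoid (Fin n)) : Setoid (Fin n) where
  r x y := S x y ∨ (S x p.1.1 ∧ S p.1.2 y) ∨ (S x p.1.2 ∧ S p.1.1 y)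
  iseqv := by
    have hs : ∀ {x y}, S x y → S y x := fun h => S.symm h
    have ht : ∀ {x y z}, S x y → S y z → S x z := fun h k => S.trans h k
    refine ⟨fun x => Or.inl (S.refl x), ?_, ?_⟩
    · rintro x y (h | ⟨h, k⟩ | ⟨h, k⟩)
      · exact Or.inl (hs h)
      · exact Or.inr (Or.inr ⟨hs k, hs h⟩)
      · exact Or.inr (Or.inl ⟨hs k, hs h⟩)
    · rintro x y z (h | ⟨h, k⟩ | ⟨h, k⟩) (h' | ⟨h', k'⟩ | ⟨h', k'⟩)
      · exact Or.inl (ht h h')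
      · exact Or.inr (Or.inl ⟨ht h h', k'⟩)
      · exact Or.inr (Or.inr ⟨ht h h', k'⟩)
      · exact Or.inr (Or.inl ⟨h, ht k h'⟩)
      · exact Or.inl (ht (ht h (hs h')) (ht (hs k) k'))
      · exact Or.inl (ht h k')
      · exact Or.inr (Or.inr ⟨h, ht k h'⟩)
      · exact Or.inl (ht h k')
      · exact Or.inl (ht (ht h (hs h')) (ht (hs k) k'))

theorem cut_apply {p : BKLIdx n} {S : Setoid (Fin n)} {x y : Fin n} :
    cut p S x y ↔ S x y ∧ (Side p x ↔ Side p y) := Iff.rfl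

theorem not_side_fst (p : BKLIdx n) : ¬ Side p p.1.1 := fun h => lt_irrefl _ h.1

theorem side_snd (p : BKLIdx n) : Side p p.1.2 := ⟨p.2, le_rfl⟩

theorem cut_le (p : BKLIdx n) (S : Setoid (Fin n)) : cut p S ≤ S := fun _ _ h => h.1

theorem cut_mono (p : BKLIdx n) {S T : Setoid (Fin n)} (h : S ≤ T) : cut p S ≤ cut p T :=
  fun _ _ k => ⟨h k.1, k.2⟩

theorem cut_comm (p q : BKLIdx n) (S : Setoid (Fin n)) :
    cut p (cut q S) = cut q (cut p S) :=
  Setoid.ext fun x y => by simp only [cut_apply]; tauto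

theorem cut_cut (p : BKLIdx n) (S : Setoid (Fin n)) : cut p (cut p S) = cut p S :=
  Setoid.ext fun x y => by simp only [cut_apply]; tauto

theorem le_join (p : BKLIdx n) (S : Setoid (Fin n)) : S ≤ join p S := fun _ _ h => Or.inl h

theorem join_self (p : BKLIdx n) (S : Setoid (Fin n)) : join p S p.1.1 p.1.2 :=
  Or.inr (Or.inl ⟨S.refl _, S.refl _⟩)

theorem join_le_iff {p : BKLIdx n} {S T : Setoid (Fin n)} :
    join p S ≤ T ↔ S ≤ T ∧ T p.1.1 p.1.2 := by
  constructor
  · exact fun h => ⟨(le_join p S).trans h, h (join_self p S)⟩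
  · rintro ⟨h, k⟩ x y (hxy | ⟨hx, hy⟩ | ⟨hx, hy⟩)
    · exact h hxy
    · exact T.trans (h hx) (T.trans k (h hy))
    · exact T.trans (h hx) (T.trans (T.symm k) (h hy))

/-- The action of a generator on partitions: if `S` records the atoms dividing `x` on the left,
then `act p S` records those dividing `σ_p x`. -/
def act (p : BKLIdx n) (S : Setoid (Fin n)) : Setoid (Fin n) := join p (cut p S)

theorem act_apply {p : BKLIdx n} {S : Setoid (Fin n)} {x y : Fin n} :
    act p S x y ↔ cut p S x y ∨ (cut p S x p.1.1 ∧ cut p S p.1.2 y) ∨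
      (cut p S x p.1.2 ∧ cut p S p.1.1 y) := Iff.rfl

theorem cut_act (p : BKLIdx n) (S : Setoid (Fin n)) : cut p (act p S) = cut p S := by
  refine Setoid.ext fun x y => ?_
  have h₁ := not_side_fst p
  have h₂ := side_snd p
  simp only [cut_apply, act_apply]
  tauto

/-- The intervals of `p` and `q` are disjoint or nested, and `p` does not separate the two
ends of `q`. -/
def Compatible (p q : BKLIdx n) : Prop :=
  (Side p q.1.1 ↔ Side p q.1.2) ∧
    ((∀ x, Side p x → Side q x) ∨ (∀ x, Side q x → Side p x) ∨ ∀ x, Side p x → ¬ Side q x)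

theorem act_act {p q : BKLIdx n} (h : Compatible p q) (S : Setoid (Fin n)) :
    act p (act q S) = join p (join q (cut q (cut p S))) := by
  obtain ⟨h₀, h⟩ := h
  have key : cut p (join q (cut q S)) = join q (cut q (cut p S)) := by
    refine le_antisymm ?_ (join_le_iff.2 ⟨?_, join_self _ _, h₀⟩)
    · have h₁ := not_side_fst q
      have h₂ := side_snd q
      rintro x y ⟨⟨hxy, hq⟩ | ⟨⟨hx, hx'⟩, hy, hy'⟩ | ⟨⟨hx, hx'⟩, hy, hy'⟩, hp⟩
      · exact Or.inl ⟨⟨hxy, hp⟩, hq⟩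
      · exact Or.inr (Or.inl ⟨⟨⟨hx, by grind⟩, hx'⟩, ⟨hy, by grind⟩, hy'⟩)
      · exact Or.inr (Or.inr ⟨⟨⟨hx, by grind⟩, hx'⟩, ⟨hy, by grind⟩, hy'⟩)
    · rw [cut_comm]
      exact cut_mono p (le_join q _)
  rw [act, act, key]

/-- The partition has no two crossing blocks. -/
def Noncrossing (S : Setoid (Fin n)) : Prop :=
  ∀ ⦃x y z w : Fin n⦄, x < y → y < z → z < w → S x z → S y w → S x y

theorem noncrossing_bot : Noncrossing (⊥ : Setoid (Fin n)) :=
  fun _ _ _ _ h₁ h₂ _ h _ => absurd h (h₁.trans h₂).ne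

theorem noncrossing_top : Noncrossing (⊤ : Setoid (Fin n)) :=
  fun _ _ _ _ _ _ _ _ _ => trivial

theorem Noncrossing.cut {S : Setoid (Fin n)} (hS : Noncrossing S) (p : BKLIdx n) :
    Noncrossing (cut p S) := by
  intro x y z w h₁ h₂ h₃ h k
  refine ⟨hS h₁ h₂ h₃ h.1 k.1, ?_⟩
  have h' := h.2
  have k' := k.2
  simp only [Side] at h' k' ⊢
  grind

theorem Noncrossing.act {S : Setoid (Fin n)} (hS : Noncrossing S) (p : BKLIdx n) :
    Noncrossing (act p S) := by
  have hT := hS.cut p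
  have hside : ∀ {x y}, BKL.cut p S x y → (Side p x ↔ Side p y) := fun h => h.2
  have hact : ∀ {x y}, BKL.act p S x y ↔ _ := fun {x y} => act_apply
  generalize BKL.cut p S = T at hT hside hact
  have hs : ∀ {x y}, T x y → T y x := fun h => T.symm h
  have ht : ∀ {x y z}, T x y → T y z → T x z := fun h k => T.trans h k
  have hT₀ := hT
  intro x y z w h₁ h₂ h₃ h k
  have e₁ := @hT x y z p.1.2 h₁ h₂
  have e₂ := @hT x y z p.1.1 h₁ h₂
  have e₃ := @hT x p.1.1 z w
  have e₄ := @hT y z w p.1.2 h₂ h₃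
  have e₅ := @hT x y p.1.1 w h₁
  have e₆ := @hT p.1.1 y z w
  have hij := p.2
  have hside' : ∀ {x y}, T x y → (p.1.1 < x ∧ x ≤ p.1.2 ↔ p.1.1 < y ∧ y ≤ p.1.2) := hside
  rw [hact] at h k ⊢
  clear hact hT hside hS
  generalize p.1.1 = i at *
  generalize p.1.2 = j at *
  rcases h with h | ⟨h, h'⟩ | ⟨h, h'⟩ <;> rcases k with k | ⟨k, k'⟩ | ⟨k, k'⟩
  · exact Or.inl (hT₀ h₁ h₂ h₃ h k)
  · have := hside' h
    have := hside' k
    have := hside' k'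
    clear hT₀ hside' e₄ e₅ e₆
    grind
  · have := hside' h
    have := hside' k
    have := hside' k'
    clear hT₀ hside' e₄ e₅ e₆
    grind
  · have := hside' h
    have := hside' k
    have := hside' h'
    clear hT₀ hside' e₁ e₂ e₃
    grind
  · exact Or.inl (ht h (hs k))
  · exact Or.inr (Or.inl ⟨h, hs k⟩)
  · have := hside' h
    have := hside' k
    have := hside' h'
    clear hT₀ hside' e₁ e₂ e₃
    grind
  · exact Or.inr (Or.inr ⟨h, hs k⟩)
  · exact Or.inl (ht h (hs k))

theorem act_eq_self {S : Setoid (Fin n)} (hS : Noncrossing S) {p : BKLIdx n}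
    (h : S p.1.1 p.1.2) : act p S = S := by
  have key : ∀ {x y}, S x y → ¬ Side p x → Side p y → S x p.1.1 := by
    intro x y hxy hx hy
    rcases eq_or_lt_of_le hy.2 with e | hyj
    · exact S.trans hxy (e ▸ S.symm h)
    rcases lt_trichotomy x p.1.1 with hxi | rfl | hxi
    · exact hS hxi hy.1 hyj hxy h
    · exact S.refl _
    · have hjx : p.1.2 < x := lt_of_not_ge fun h' => hx ⟨hxi, h'⟩
      exact S.trans hxy (S.symm (hS hy.1 hyj hjx h (S.symm hxy)))
  have hi := not_side_fst p
  have hj := side_snd p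
  refine le_antisymm (join_le_iff.2 ⟨cut_le p S, h⟩) fun x y hxy => ?_
  rw [act_apply]
  simp only [cut_apply]
  by_cases hx : Side p x <;> by_cases hy : Side p y
  · exact Or.inl ⟨hxy, by tauto⟩
  · have hyi := key (S.symm hxy) hy hx
    exact Or.inr (Or.inr ⟨⟨S.trans hxy (S.trans hyi h), by tauto⟩, S.symm hyi, by tauto⟩)
  · have hxi := key hxy hx hy
    exact Or.inr (Or.inl ⟨⟨hxi, by tauto⟩, S.trans (S.symm h) (S.trans (S.symm hxi) hxy), by tauto⟩)
  · exact Or.inl ⟨hxy, by tauto⟩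

theorem sign_condition_iff {s t q r : ℕ} (hst : s < t) (hqr : q < r) :
    ((t : ℤ) - r) * ((t : ℤ) - q) * ((s : ℤ) - r) * ((s : ℤ) - q) > 0 ↔
      t < q ∨ r < s ∨ (s < q ∧ r < t) ∨ (q < s ∧ t < r) := by
  simp only [gt_iff_lt, mul_pos_iff, mul_neg_iff]
  omega

/-- The image of a Birman–Ko–Lee generator in the monoid. -/
def atom (p : BKLIdx n) : BKLMonoid n := (conGen (BKLMonoidRel n)).mk' (FreeMonoid.of p)

theorem mk_eq_of_rel {X Y : FreeMonoid (BKLIdx n)} (h : BKLMonoidRel n X Y) :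
    (conGen (BKLMonoidRel n)).mk' X = (conGen (BKLMonoidRel n)).mk' Y :=
  (Con.eq _).2 (ConGen.Rel.of _ _ h)

theorem atom_comm {p q : BKLIdx n}
    (h : p.1.2 < q.1.1 ∨ q.1.2 < p.1.1 ∨ (p.1.1 < q.1.1 ∧ q.1.2 < p.1.2) ∨
      (q.1.1 < p.1.1 ∧ p.1.2 < q.1.2)) :
    atom p * atom q = atom q * atom p := by
  have := mk_eq_of_rel (BKLMonoidRel.comm p q ((sign_condition_iff p.2 q.2).2 h))
  exact this

theorem atom_triangle_left {r s t : Fin n} (hrs : r < s) (hst : s < t) :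
    atom ⟨(s, t), hst⟩ * atom ⟨(r, s), hrs⟩ =
      atom ⟨(r, t), hrs.trans hst⟩ * atom ⟨(s, t), hst⟩ := by
  have := mk_eq_of_rel (BKLMonoidRel.triangleA r s t hrs hst)
  exact this

theorem atom_triangle_right {r s t : Fin n} (hrs : r < s) (hst : s < t) :
    atom ⟨(s, t), hst⟩ * atom ⟨(r, s), hrs⟩ =
      atom ⟨(r, s), hrs⟩ * atom ⟨(r, t), hrs.trans hst⟩ := by
  have := mk_eq_of_rel (BKLMonoidRel.triangleB r s t hrs hst)
  exact this

theorem induction_on {C : BKLMonoid n → Prop} (x : BKLMonoid n) (one : C 1)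
    (atom_mul : ∀ p x, C x → C (atom p * x)) : C x := by
  induction x using Con.induction_on with
  | H X =>
    induction X using FreeMonoid.inductionOn' with
    | one => exact one
    | of_mul p X ih => exact atom_mul p _ ih

/-- A defining relation equates two products `σ_a σ_b` and `σ_c σ_d` of compatible pairs which
have the same effect on partitions. -/
theorem BKLMonoidRel.exists_compatible {X Y : FreeMonoid (BKLIdx n)} (h : BKLMonoidRel n X Y) :
    ∃ a b c d : BKLIdx n, X = FreeMonoid.of a * FreeMonoid.of b ∧
      Y = FreeMonoid.of c * FreeMonoid.of d ∧ Compatible a b ∧ Compatible c d ∧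
      (∀ S, cut b (cut a S) = cut d (cut c S)) ∧ ∀ S, join a (join b S) = join c (join d S) := by
  induction h with
  | comm p q h =>
    refine ⟨p, q, q, p, rfl, rfl, ?_, ?_, fun S => cut_comm _ _ _, fun S => ?_⟩
    · have := p.2
      have := q.2
      rw [sign_condition_iff p.2 q.2] at h
      simp only [Compatible, Side]
      refine ⟨by omega, ?_⟩
      rcases h with h | h | h | h
      · exact Or.inr (Or.inr fun x => by omega)
      · exact Or.inr (Or.inr fun x => by omega)
      · exact Or.inr (Or.inl fun x => by omega)
      · exact Or.inl fun x => by omega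
    · have := p.2
      have := q.2
      rw [sign_condition_iff p.2 q.2] at h
      simp only [Compatible, Side]
      refine ⟨by omega, ?_⟩
      rcases h with h | h | h | h
      · exact Or.inr (Or.inr fun x => by omega)
      · exact Or.inr (Or.inr fun x => by omega)
      · exact Or.inl fun x => by omega
      · exact Or.inr (Or.inl fun x => by omega)
    · refine eq_of_forall_ge_iff fun T => ?_
      simp only [join_le_iff]
      tauto
  | triangleA r s t hrs hst =>
    refine ⟨_, _, _, _, rfl, rfl, ?_, ?_, fun S => ?_, fun S => ?_⟩
    · simp only [Compatible, Side]
      exact ⟨by omega, Or.inr (Or.inr fun x => by omega)⟩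
    · simp only [Compatible, Side]
      exact ⟨by omega, Or.inr (Or.inl fun x => by omega)⟩
    · refine Setoid.ext fun x y => ?_
      simp only [cut_apply, and_assoc, Side]
      exact and_congr_right fun _ => by omega
    · refine eq_of_forall_ge_iff fun T => ?_
      simp only [join_le_iff]
      constructor
      · rintro ⟨⟨h, h₁⟩, h₂⟩
        exact ⟨⟨h, h₂⟩, T.trans h₁ h₂⟩
      · rintro ⟨⟨h, h₁⟩, h₂⟩
        exact ⟨⟨h, T.trans h₂ (T.symm h₁)⟩, h₁⟩
  | triangleB r s t hrs hst =>
    refine ⟨_, _, _, _, rfl, rfl, ?_, ?_, fun S => ?_, fun S => ?_⟩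
    · simp only [Compatible, Side]
      exact ⟨by omega, Or.inr (Or.inr fun x => by omega)⟩
    · simp only [Compatible, Side]
      exact ⟨by omega, Or.inl fun x => by omega⟩
    · refine Setoid.ext fun x y => ?_
      simp only [cut_apply, and_assoc, Side]
      exact and_congr_right fun _ => by omega
    · refine eq_of_forall_ge_iff fun T => ?_
      simp only [join_le_iff]
      constructor
      · rintro ⟨⟨h, h₁⟩, h₂⟩
        exact ⟨⟨h, T.trans h₁ h₂⟩, h₁⟩
      · rintro ⟨⟨h, h₁⟩, h₂⟩
        exact ⟨⟨h, h₂⟩, T.trans (T.symm h₂) h₁⟩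

/-- The number of generators in any word representing an element of the monoid. -/
def lengthHom (n : ℕ) : BKLMonoid n →* Multiplicative ℕ :=
  (conGen (BKLMonoidRel n)).lift (FreeMonoid.lift fun _ => Multiplicative.ofAdd 1) <|
    Con.conGen_le.2 fun _ _ h => by
      obtain ⟨a, b, c, d, rfl, rfl, -⟩ := BKLMonoidRel.exists_compatible h
      simp [Con.ker_rel]

/-- The word length of an element of the monoid. -/
def len (x : BKLMonoid n) : ℕ := (lengthHom n x).toAdd

theorem len_one : len (1 : BKLMonoid n) = 0 := by simp [len]

theorem len_mul (x y : BKLMonoid n) : len (x * y) = len x + len y := by simp [len]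

theorem len_atom (p : BKLIdx n) : len (atom p) = 1 := rfl

theorem eq_one_of_len {x : BKLMonoid n} (h : len x = 0) : x = 1 := by
  induction x using induction_on with
  | one => rfl
  | atom_mul p x _ => simp [len_mul, len_atom] at h

/-- The monoid acts on partitions through `act`. -/
def actHom (n : ℕ) : BKLMonoid n →* Function.End (Setoid (Fin n)) :=
  (conGen (BKLMonoidRel n)).lift (FreeMonoid.lift act) <|
    Con.conGen_le.2 fun _ _ h => by
      obtain ⟨a, b, c, d, rfl, rfl, hab, hcd, hcut, hjoin⟩ := BKLMonoidRel.exists_compatible h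
      rw [Con.ker_rel, map_mul, map_mul]
      funext S
      change act a (act b S) = act c (act d S)
      rw [act_act hab, act_act hcd, hcut, hjoin]

/-- The partition whose blocks join `s` and `t` exactly when `σ_{s,t}` divides `x` on the left. -/
def leftPart (x : BKLMonoid n) : Setoid (Fin n) := actHom n x ⊥

theorem leftPart_one : leftPart (1 : BKLMonoid n) = ⊥ := by
  rw [leftPart, map_one]; rfl

theorem leftPart_atom_mul (p : BKLIdx n) (x : BKLMonoid n) :
    leftPart (atom p * x) = act p (leftPart x) := by
  rw [leftPart, map_mul]; rfl

theorem noncrossing_leftPart (x : BKLMonoid n) : Noncrossing (leftPart x) := by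
  induction x using induction_on with
  | one => exact leftPart_one ▸ noncrossing_bot
  | atom_mul p x ih => exact leftPart_atom_mul p x ▸ ih.act p

/-- The generator attached to an unordered pair of strands, or `1` if the strands agree. -/
def edge (x y : Fin n) : BKLMonoid n :=
  if h : x < y then atom ⟨(x, y), h⟩ else if h : y < x then atom ⟨(y, x), h⟩ else 1

theorem edge_of_lt {x y : Fin n} (h : x < y) : edge x y = atom ⟨(x, y), h⟩ := dif_pos h

theorem edge_of_gt {x y : Fin n} (h : y < x) : edge x y = atom ⟨(y, x), h⟩ := by
  rw [edge, dif_neg h.not_gt, dif_pos h]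

theorem edge_self (x : Fin n) : edge x x = 1 := by simp [edge]

theorem edge_comm (x y : Fin n) : edge x y = edge y x := by
  rcases lt_trichotomy x y with h | rfl | h
  · rw [edge_of_lt h, edge_of_gt h]
  · rfl
  · rw [edge_of_lt h, edge_of_gt h]

theorem edge_dvd_of_side_iff (b : BKLIdx n) {x y : Fin n} (h : Side b x ↔ Side b y) :
    edge x y ∣ atom b * edge x y := by
  wlog hxy : x < y generalizing x y
  · rcases (not_lt.1 hxy).eq_or_lt with rfl | hyx
    · rw [edge_self]
      exact one_dvd _
    · rw [edge_comm x y]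
      exact this h.symm hyx
  obtain ⟨⟨i, j⟩, hij⟩ := b
  simp only [Side] at h hij
  rw [edge_of_lt hxy]
  have trichotomy : (j < x ∨ y < i ∨ (i < x ∧ y < j) ∨ (x < i ∧ j < y)) ∨ (x = i ∧ y = j) ∨ y = i ∨
      (x = i ∧ j < y) ∨ (y = j ∧ i < x) := by omega
  rcases trichotomy with h | ⟨rfl, rfl⟩ | rfl | ⟨rfl, hjy⟩ | ⟨rfl, hix⟩
  · exact ⟨_, atom_comm h⟩
  · exact ⟨_, rfl⟩
  · exact ⟨_, atom_triangle_right hxy hij⟩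
  · exact ⟨_, (atom_triangle_right hij hjy).symm.trans (atom_triangle_left hij hjy)⟩
  · exact ⟨_, (atom_triangle_left hix hxy).symm⟩

theorem edge_dvd_of_leftPart {z : BKLMonoid n} {x y : Fin n} (h : leftPart z x y) :
    edge x y ∣ z := by
  induction hℓ : len z generalizing z x y with
  | zero =>
    obtain rfl := eq_one_of_len hℓ
    rw [leftPart_one] at h
    obtain rfl : x = y := h
    rw [edge_self]
  | succ ℓ ih =>
    induction z using induction_on with
    | one => simp [len_one] at hℓ
    | atom_mul b z _ =>
      rw [len_mul, len_atom, add_comm, Nat.add_right_cancel_iff] at hℓ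
      have key : ∀ {x y}, cut b (leftPart z) x b.1.1 → cut b (leftPart z) b.1.2 y →
          edge x y ∣ atom b * z := by
        intro x y hx hy
        have hact : leftPart (atom b * z) x b.1.1 := by
          rw [leftPart_atom_mul]
          exact le_join _ _ hx
        have hxs : ¬ Side b x := fun h => not_side_fst b (hx.2.1 h)
        obtain ⟨hiy, hyj⟩ : Side b y := hy.2.1 (side_snd b)
        obtain ⟨w, hw⟩ : atom ⟨(b.1.1, y), hiy⟩ ∣ atom b * z := by
          refine dvd_trans ?_ (mul_dvd_mul_left (atom b) (ih hy.1 hℓ))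
          obtain ⟨⟨i, j⟩, hij⟩ := b
          rcases hyj.eq_or_lt with rfl | hyj
          · exact dvd_mul_right _ _
          · rw [edge_of_gt hyj]
            exact ⟨_, (atom_triangle_left hiy hyj).symm.trans (atom_triangle_right hiy hyj)⟩
        have hlen : len w = ℓ := by
          have := congrArg len hw
          simp only [len_mul, len_atom] at this
          omega
        rw [hw] at hact ⊢
        have hwx : leftPart w x b.1.1 := by
          have : cut ⟨(b.1.1, y), hiy⟩ (leftPart (atom ⟨(b.1.1, y), hiy⟩ * w)) x b.1.1 := by
            refine ⟨hact, ?_⟩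
            simp only [Side] at hxs ⊢
            omega
          rw [leftPart_atom_mul, cut_act] at this
          exact this.1
        refine dvd_trans ?_ (mul_dvd_mul_left _ (ih hwx hlen))
        simp only [Side] at hxs
        rcases lt_trichotomy x b.1.1 with h | rfl | h
        · rw [edge_of_lt h, edge_of_lt (h.trans hiy)]
          exact ⟨_, atom_triangle_left h hiy⟩
        · rw [edge_of_lt hiy]
          exact dvd_mul_right _ _
        · have hyx : y < x := by omega
          rw [edge_of_gt h, edge_of_gt hyx]
          exact ⟨_, (atom_triangle_right hiy hyx).symm⟩
      rw [leftPart_atom_mul, act_apply] at h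
      rcases h with h | ⟨h, k⟩ | ⟨h, k⟩
      · exact (edge_dvd_of_side_iff b h.2).trans (mul_dvd_mul_left _ (ih h.1 hℓ))
      · exact key h k
      · rw [edge_comm]
        exact key (Setoid.symm' _ k) (Setoid.symm' _ h)

theorem atom_dvd_of_leftPart {z : BKLMonoid n} {p : BKLIdx n} (h : leftPart z p.1.1 p.1.2) :
    atom p ∣ z :=
  edge_of_lt p.2 ▸ edge_dvd_of_leftPart h

/-- An element is simple if it divides on the left every element whose left partition is at least
as coarse as its own. -/
def Simple (m : BKLMonoid n) : Prop := ∀ z, leftPart m ≤ leftPart z → m ∣ z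

theorem simple_one : Simple (1 : BKLMonoid n) := fun z _ => one_dvd z

theorem leftPart_atom_mul_of_eq_cut {S : Setoid (Fin n)} (hS : Noncrossing S) {p : BKLIdx n}
    (hp : S p.1.1 p.1.2) {m : BKLMonoid n} (h : leftPart m = cut p S) :
    leftPart (atom p * m) = S := by
  rw [leftPart_atom_mul, h, act, cut_cut]
  exact act_eq_self hS hp

theorem Simple.atom_mul {S : Setoid (Fin n)} (hS : Noncrossing S) {p : BKLIdx n}
    (hp : S p.1.1 p.1.2) {m : BKLMonoid n} (hm : Simple m) (h : leftPart m = cut p S) :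
    Simple (atom p * m) := by
  intro z hz
  rw [leftPart_atom_mul_of_eq_cut hS hp h] at hz
  obtain ⟨w, rfl⟩ := atom_dvd_of_leftPart (hz hp)
  refine mul_dvd_mul_left _ (hm w ?_)
  have := cut_mono p hz
  rw [leftPart_atom_mul, cut_act] at this
  exact h ▸ this.trans (cut_le p _)

theorem exists_simple {S : Setoid (Fin n)} (hS : Noncrossing S) :
    ∃ m : BKLMonoid n, Simple m ∧ leftPart m = S := by
  have : Finite (Setoid (Fin n)) :=
    Finite.of_injective (fun S x y => S x y) fun S T h =>
      Setoid.ext fun x y => iff_of_eq (congrFun (congrFun h x) y)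
  induction S using WellFoundedLT.induction with
  | ind S ih =>
    by_cases h : ∃ p : BKLIdx n, S p.1.1 p.1.2
    · obtain ⟨p, hp⟩ := h
      have hlt : cut p S < S := by
        refine lt_of_le_of_ne (cut_le p S) fun e => ?_
        have : cut p S p.1.1 p.1.2 := by rwa [e]
        exact not_side_fst p (this.2.2 (side_snd p))
      obtain ⟨m, hm, hmS⟩ := ih _ hlt (hS.cut p)
      exact ⟨atom p * m, hm.atom_mul hS hp hmS, leftPart_atom_mul_of_eq_cut hS hp hmS⟩
    · refine ⟨1, simple_one, ?_⟩
      rw [leftPart_one]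
      refine le_antisymm bot_le fun x y hxy => ?_
      push Not at h
      rcases lt_trichotomy x y with hlt | rfl | hlt
      · exact absurd hxy (h ⟨(x, y), hlt⟩)
      · exact Setoid.refl' _ _
      · exact absurd (Setoid.symm' _ hxy) (h ⟨(y, x), hlt⟩)

theorem Simple.ext {m m' : BKLMonoid n} (hm : Simple m) (hm' : Simple m')
    (h : leftPart m = leftPart m') : m = m' := by
  obtain ⟨u, hu⟩ := hm m' h.le
  obtain ⟨v, hv⟩ := hm' m h.ge
  have hlen : len u = 0 := by
    have h₁ := congrArg len hu
    have h₂ := congrArg len hv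
    rw [len_mul] at h₁ h₂
    omega
  rw [hu, eq_one_of_len hlen, mul_one]

theorem mk_of_mul (p : BKLIdx n) (Z : FreeMonoid (BKLIdx n)) :
    (conGen (BKLMonoidRel n)).mk' (FreeMonoid.of p * Z) =
      atom p * (conGen (BKLMonoidRel n)).mk' Z := rfl

/-- For a word `X = σ_p Z`, the element `r` is what remains of `Z` after removing the simple
element whose left partition is that of `X` cut along `p`. -/
def IsRemainder (X : FreeMonoid (BKLIdx n)) (r : BKLMonoid n) : Prop :=
  ∃ p Z m, X = FreeMonoid.of p * Z ∧ Simple m ∧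
    leftPart m = cut p (leftPart ((conGen (BKLMonoidRel n)).mk' X)) ∧
    (conGen (BKLMonoidRel n)).mk' Z = m * r

theorem isRemainder_of_mul {p : BKLIdx n} {Z : FreeMonoid (BKLIdx n)} {r : BKLMonoid n} :
    IsRemainder (FreeMonoid.of p * Z) r ↔ ∃ m, Simple m ∧
      leftPart m = cut p (leftPart (atom p * (conGen (BKLMonoidRel n)).mk' Z)) ∧
      (conGen (BKLMonoidRel n)).mk' Z = m * r := by
  constructor
  · rintro ⟨q, W, m, h, hm⟩
    obtain ⟨rfl, rfl⟩ : p = q ∧ Z = W := by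
      have := congrArg FreeMonoid.toList h
      simpa using this
    exact ⟨m, hm⟩
  · rintro ⟨m, hm⟩
    exact ⟨p, Z, m, rfl, hm⟩

theorem leftPart_apply_of_compatible {a b : BKLIdx n} (h : Compatible a b) (t : BKLMonoid n) :
    cut a (leftPart (atom a * (atom b * t))) b.1.1 b.1.2 := by
  refine ⟨?_, h.1⟩
  rw [leftPart_atom_mul, leftPart_atom_mul, act_act h]
  exact le_join _ _ (join_self _ _)

/-- Cancellation of `σ_p` in front of elements of length less than `ℓ`. -/
def CancelsBelow (n ℓ : ℕ) : Prop :=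
  ∀ (p : BKLIdx n) (z z' : BKLMonoid n), len z < ℓ → atom p * z = atom p * z' → z = z'

theorem CancelsBelow.mul_left_cancel {ℓ : ℕ} (H : CancelsBelow n ℓ) (m : BKLMonoid n)
    {z z' : BKLMonoid n} (hlen : len (m * z) ≤ ℓ) (h : m * z = m * z') : z = z' := by
  induction m using induction_on with
  | one => simpa using h
  | atom_mul p m ih =>
    rw [mul_assoc, len_mul, len_atom] at hlen
    rw [mul_assoc, mul_assoc] at h
    exact ih (by omega) (H p _ _ (by omega) h)

theorem CancelsBelow.isRemainder_of_rel {ℓ : ℕ} (H : CancelsBelow n ℓ) {a b c d : BKLIdx n}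
    (hmul : atom a * atom b = atom c * atom d) (hab : Compatible a b) (hcd : Compatible c d)
    (hcut : ∀ S, cut b (cut a S) = cut d (cut c S)) {T : FreeMonoid (BKLIdx n)}
    (hlen : len (atom a * (atom b * (conGen (BKLMonoidRel n)).mk' T)) = ℓ + 1) {r : BKLMonoid n}
    (h : IsRemainder (FreeMonoid.of a * (FreeMonoid.of b * T)) r) :
    IsRemainder (FreeMonoid.of c * (FreeMonoid.of d * T)) r := by
  rw [isRemainder_of_mul, mk_of_mul] at h ⊢
  obtain ⟨m, hm, hmL, hr⟩ := h
  generalize (conGen (BKLMonoidRel n)).mk' T = t at *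
  have hw : atom a * (atom b * t) = atom c * (atom d * t) := by
    rw [← mul_assoc, hmul, mul_assoc]
  have hb := leftPart_apply_of_compatible hab t
  have hd := leftPart_apply_of_compatible hcd t
  rw [← hw] at hd ⊢
  have hL := noncrossing_leftPart (atom a * (atom b * t))
  obtain ⟨m₀, hm₀, hm₀L⟩ := exists_simple ((hL.cut a).cut b)
  obtain ⟨r₀, rfl⟩ := hm₀ t <| by
    rw [hm₀L, leftPart_atom_mul, cut_act]
    refine (cut_mono b (cut_le a _)).trans ?_
    rw [leftPart_atom_mul, cut_act]
    exact cut_le b _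
  obtain rfl : atom b * m₀ = m := (hm₀.atom_mul (hL.cut a) hb hm₀L).ext hm <| by
    rw [leftPart_atom_mul_of_eq_cut (hL.cut a) hb hm₀L, hmL]
  rw [hcut] at hm₀L
  refine ⟨atom d * m₀, hm₀.atom_mul (hL.cut c) hd hm₀L,
    leftPart_atom_mul_of_eq_cut (hL.cut c) hd hm₀L, ?_⟩
  rw [← mul_assoc] at hr
  rw [len_mul, len_atom] at hlen
  rw [mul_assoc, H.mul_left_cancel (atom b * m₀) _ hr]
  rw [mul_assoc]
  omega

theorem CancelsBelow.isRemainder_congr {ℓ : ℕ} (H : CancelsBelow n ℓ)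
    {X X' : FreeMonoid (BKLIdx n)} (h : ConGen.Rel (BKLMonoidRel n) X X')
    (T : FreeMonoid (BKLIdx n)) (hlen : len ((conGen (BKLMonoidRel n)).mk' (X * T)) = ℓ + 1)
    (r : BKLMonoid n) : IsRemainder (X * T) r ↔ IsRemainder (X' * T) r := by
  induction h generalizing T with
  | of X X' h =>
    have hmul := mk_eq_of_rel h
    obtain ⟨a, b, c, d, rfl, rfl, hab, hcd, hcut, -⟩ := BKLMonoidRel.exists_compatible h
    have hmul : atom a * atom b = atom c * atom d := hmul
    rw [mul_assoc, mk_of_mul, mk_of_mul] at hlen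
    rw [mul_assoc, mul_assoc]
    refine ⟨H.isRemainder_of_rel hmul hab hcd hcut hlen,
      H.isRemainder_of_rel hmul.symm hcd hab (fun S => (hcut S).symm) ?_⟩
    rwa [← mul_assoc, ← hmul, mul_assoc]
  | refl X => rfl
  | @symm X X' h ih =>
    have e : (conGen (BKLMonoidRel n)).mk' X = (conGen (BKLMonoidRel n)).mk' X' :=
      (Con.eq _).2 h
    refine (ih T ?_).symm
    rwa [map_mul, e, ← map_mul]
  | @trans X X' X'' h h' ih ih' =>
    have e : (conGen (BKLMonoidRel n)).mk' X = (conGen (BKLMonoidRel n)).mk' X' :=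
      (Con.eq _).2 h
    refine (ih T hlen).trans (ih' T ?_)
    rwa [map_mul, ← e, ← map_mul]
  | @mul W X Y Z h h' ih ih' =>
    have e : (conGen (BKLMonoidRel n)).mk' W = (conGen (BKLMonoidRel n)).mk' X :=
      (Con.eq _).2 h
    have e' : (conGen (BKLMonoidRel n)).mk' Y = (conGen (BKLMonoidRel n)).mk' Z :=
      (Con.eq _).2 h'
    rw [mul_assoc] at hlen
    rw [mul_assoc, mul_assoc, ih (Y * T) hlen]
    rw [map_mul, e, ← map_mul] at hlen
    clear ih h e
    cases X using FreeMonoid.casesOn with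
    | one =>
      rw [one_mul] at hlen
      simpa only [one_mul] using ih' T hlen
    | of_mul p X =>
      rw [mul_assoc, mul_assoc, isRemainder_of_mul, isRemainder_of_mul]
      simp only [map_mul, e']

theorem atom_mul_left_cancel (p : BKLIdx n) {z z' : BKLMonoid n}
    (h : atom p * z = atom p * z') : z = z' := by
  suffices ∀ ℓ, CancelsBelow n ℓ from this (len z + 1) p z z' (Nat.lt_succ_self _) h
  clear h z z' p
  intro ℓ
  induction ℓ with
  | zero => exact fun p z z' h => absurd h (Nat.not_lt_zero _)
  | succ ℓ H =>
    intro p z z' hlen h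
    rcases (Nat.lt_succ_iff.1 hlen).lt_or_eq with hlt | hlen
    · exact H p z z' hlt h
    obtain ⟨m, hm, hmL⟩ := exists_simple ((noncrossing_leftPart (atom p * z)).cut p)
    obtain ⟨r, hr⟩ := hm z <| by
      rw [hmL, leftPart_atom_mul, cut_act]
      exact cut_le p _
    obtain ⟨Z, rfl⟩ := Con.mk'_surjective z
    obtain ⟨Z', rfl⟩ := Con.mk'_surjective z'
    have hrel : ConGen.Rel (BKLMonoidRel n) (FreeMonoid.of p * Z) (FreeMonoid.of p * Z') :=
      (Con.eq _).1 h
    have := (H.isRemainder_congr hrel 1 (by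
      rw [mul_one, mk_of_mul, len_mul, len_atom, hlen, add_comm]) r).1
      (by rw [mul_one, isRemainder_of_mul]; exact ⟨m, hm, hmL, hr⟩)
    rw [mul_one, isRemainder_of_mul] at this
    obtain ⟨m', hm', hmL', hr'⟩ := this
    rw [hr, hr', hm.ext hm' (by rw [hmL, hmL', h])]

theorem mul_left_cancel' (m : BKLMonoid n) {z z' : BKLMonoid n} (h : m * z = m * z') : z = z' := by
  induction m using induction_on with
  | one => simpa using h
  | atom_mul p m ih =>
    rw [mul_assoc, mul_assoc] at h
    exact ih (atom_mul_left_cancel p h)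

/-- The mirror image of a generator, exchanging the strands `i` and `n - 1 - i`. -/
def mirror (p : BKLIdx n) : BKLIdx n := ⟨(p.1.2.rev, p.1.1.rev), Fin.rev_lt_rev.2 p.2⟩

/-- The anti-automorphism of the monoid taking each generator to its mirror image. -/
def mirrorHom (n : ℕ) : BKLMonoid n →* (BKLMonoid n)ᵐᵒᵖ :=
  (conGen (BKLMonoidRel n)).lift
    (FreeMonoid.lift fun p => MulOpposite.op (atom (mirror p))) <|
    Con.conGen_le.2 fun _ _ h => by
      rw [Con.ker_rel]
      induction h with
      | comm p q h =>
        rw [sign_condition_iff p.2 q.2] at h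
        simp only [map_mul, FreeMonoid.lift_eval_of, ← MulOpposite.op_mul]
        rw [atom_comm]
        simp only [mirror, Fin.rev_lt_rev]
        tauto
      | triangleA r s t hrs hst =>
        simp only [map_mul, FreeMonoid.lift_eval_of, ← MulOpposite.op_mul]
        exact congrArg _ (atom_triangle_right (Fin.rev_lt_rev.2 hst) (Fin.rev_lt_rev.2 hrs))
      | triangleB r s t hrs hst =>
        simp only [map_mul, FreeMonoid.lift_eval_of, ← MulOpposite.op_mul]
        exact congrArg _ (atom_triangle_left (Fin.rev_lt_rev.2 hst) (Fin.rev_lt_rev.2 hrs))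

/-- The mirror image of an element. -/
def flip (x : BKLMonoid n) : BKLMonoid n := (mirrorHom n x).unop

theorem flip_mul (x y : BKLMonoid n) : flip (x * y) = flip y * flip x := by simp [flip]

theorem flip_atom (p : BKLIdx n) : flip (atom p) = atom (mirror p) := rfl

theorem flip_flip (x : BKLMonoid n) : flip (flip x) = x := by
  induction x using induction_on with
  | one => simp [flip]
  | atom_mul p x ih =>
    rw [flip_mul, flip_mul, ih, flip_atom, flip_atom]
    congr 2
    simp [mirror]

theorem mul_right_cancel' (m : BKLMonoid n) {z z' : BKLMonoid n} (h : z * m = z' * m) :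
    z = z' := by
  rw [← flip_flip z, ← flip_flip z']
  refine congrArg flip (mul_left_cancel' (flip m) ?_)
  rw [← flip_mul, ← flip_mul, h]

theorem exists_garside_element (n : ℕ) :
    ∃ δ : BKLMonoid n, (∀ p, atom p ∣ δ) ∧ ∀ y, δ ∣ y * δ := by
  obtain ⟨δ, hδ, hL⟩ := exists_simple (noncrossing_top (n := n))
  have key : ∀ p, ∃ m, δ = atom p * m ∧ m ∣ δ := by
    intro p
    obtain ⟨m, hm, hmL⟩ := exists_simple ((noncrossing_top (n := n)).cut p)
    refine ⟨m, hδ.ext (hm.atom_mul noncrossing_top trivial hmL) ?_, hm δ (hL ▸ le_top)⟩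
    rw [hL, leftPart_atom_mul_of_eq_cut noncrossing_top trivial hmL]
  refine ⟨δ, fun p => ?_, fun y => ?_⟩
  · obtain ⟨m, hm, -⟩ := key p
    exact ⟨m, hm⟩
  · induction y using induction_on with
    | one => rw [one_mul]
    | atom_mul p y ih =>
      obtain ⟨m, hm, c, hc⟩ := key p
      rw [mul_assoc]
      refine dvd_trans ⟨c, ?_⟩ (mul_dvd_mul_left _ ih)
      conv_lhs => rw [hc, ← mul_assoc, ← hm]

theorem exists_common_right_multiple (x y : BKLMonoid n) : ∃ u v, x * u = y * v := by
  obtain ⟨δ, hdvd, hδ⟩ := exists_garside_element n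
  induction x using induction_on generalizing y with
  | one => exact ⟨y, 1, by rw [one_mul, mul_one]⟩
  | atom_mul p x ih =>
    obtain ⟨u, hu⟩ := (hdvd p).trans (hδ y)
    obtain ⟨v, w, h⟩ := ih u
    exact ⟨v, δ * w, by rw [mul_assoc, h, ← mul_assoc, ← hu, mul_assoc]⟩

theorem exists_common_left_multiple (x y : BKLMonoid n) : ∃ u v, u * x = v * y := by
  obtain ⟨u, v, h⟩ := exists_common_right_multiple (flip x) (flip y)
  refine ⟨flip u, flip v, ?_⟩
  have := congrArg flip h
  rwa [flip_mul, flip_mul, flip_flip, flip_flip] at this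

theorem exists_injective_hom_to_group (n : ℕ) :
    ∃ (G : Type) (_ : Group G) (ι : BKLMonoid n →* G), Function.Injective ι := by
  choose u v h using exists_common_left_multiple (n := n)
  let _ : OreLocalization.OreSet (⊤ : Submonoid (BKLMonoid n)) :=
    { ore_right_cancel := fun r₁ r₂ s h => ⟨1, by rw [mul_right_cancel' _ h]⟩
      oreNum := fun r s => v r s
      oreDenom := fun r s => ⟨u r s, trivial⟩
      ore_eq := fun r s => h r s }
  have hunit (x : BKLMonoid n) :
      IsUnit (OreLocalization.numeratorHom (S := (⊤ : Submonoid (BKLMonoid n))) x) :=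
    OreLocalization.numerator_isUnit (⟨x, trivial⟩ : (⊤ : Submonoid (BKLMonoid n)))
  refine ⟨_, inferInstance, IsUnit.liftRight OreLocalization.numeratorHom hunit, ?_⟩
  intro x y hxy
  have hxy := congrArg Units.val hxy
  rw [IsUnit.coe_liftRight, IsUnit.coe_liftRight, OreLocalization.numeratorHom_apply,
    OreLocalization.numeratorHom_apply, OreLocalization.oreDiv_eq_iff] at hxy
  obtain ⟨s, t, h₁, h₂⟩ := hxy
  rw [OneMemClass.coe_one, mul_one, mul_one] at h₂
  rw [Submonoid.smul_def, smul_eq_mul, smul_eq_mul, h₂] at h₁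
  exact (mul_left_cancel' t h₁).symm

theorem sigmaB_commute {i k : ℕ} (h : i + 2 ≤ k) : Commute (sigmaB n i) (sigmaB n k) := by
  unfold sigmaB
  split_ifs with hi hk
  · have : FreeGroup.of (⟨i, hi⟩ : Fin (n - 1)) * FreeGroup.of ⟨k, hk⟩ *
        (FreeGroup.of ⟨k, hk⟩ * FreeGroup.of ⟨i, hi⟩)⁻¹ ∈ braidRels n :=
      Or.inl ⟨_, _, h, rfl⟩
    exact PresentedGroup.mk_eq_mk_of_mul_inv_mem this
  · exact Commute.one_right _
  · exact Commute.one_left _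
  · exact Commute.one_left _

theorem sigmaB_braid {i : ℕ} (h : i + 2 < n) :
    sigmaB n i * sigmaB n (i + 1) * sigmaB n i =
      sigmaB n (i + 1) * sigmaB n i * sigmaB n (i + 1) := by
  have hi : i < n - 1 := by omega
  have hk : i + 1 < n - 1 := by omega
  rw [sigmaB, sigmaB, dif_pos hi, dif_pos hk]
  have : FreeGroup.of (⟨i, hi⟩ : Fin (n - 1)) * FreeGroup.of ⟨i + 1, hk⟩ * FreeGroup.of ⟨i, hi⟩ *
      (FreeGroup.of ⟨i + 1, hk⟩ * FreeGroup.of ⟨i, hi⟩ * FreeGroup.of ⟨i + 1, hk⟩)⁻¹ ∈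
        braidRels n := Or.inr ⟨_, _, rfl, rfl⟩
  exact PresentedGroup.mk_eq_mk_of_mul_inv_mem this

theorem bandWord_self_succ (n a : ℕ) : bandWord n a (a + 1) = sigmaB n a := by
  rw [bandWord, if_pos rfl]

theorem bandWord_succ {a b : ℕ} (h : a < b) :
    bandWord n a (b + 1) = sigmaB n b * bandWord n a b * (sigmaB n b)⁻¹ := by
  rw [bandWord, if_neg h.ne']

theorem commute_bandWord_of_forall {x : BraidGroup n} {a b : ℕ} (hab : a < b)
    (h : ∀ k, a ≤ k → k < b → Commute x (sigmaB n k)) : Commute x (bandWord n a b) := by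
  induction b, hab using Nat.le_induction with
  | base => exact bandWord_self_succ n a ▸ h a le_rfl (Nat.lt_succ_self a)
  | succ b hab ih =>
    have hb := h b (by omega) (Nat.lt_succ_self b)
    rw [bandWord_succ hab]
    exact (hb.mul_right (ih fun k hk hkb => h k hk (by omega))).mul_right hb.inv_right

theorem sigmaB_commute_bandWord_of_disjoint {i a b : ℕ} (hab : a < b) (h : i + 1 < a ∨ b < i) :
    Commute (sigmaB n i) (bandWord n a b) := by
  refine commute_bandWord_of_forall hab fun k hk hkb => ?_
  rcases h with h | h
  · exact sigmaB_commute (by omega)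
  · exact (sigmaB_commute (by omega)).symm

theorem sigmaB_commute_bandWord_of_nested {i a b : ℕ} (hai : a < i) (hib : i + 1 < b)
    (hbn : b < n) : Commute (sigmaB n i) (bandWord n a b) := by
  induction b, hib using Nat.le_induction with
  | base =>
    have hk : sigmaB n (i + 1) * sigmaB n i * sigmaB n (i + 1) *
        (sigmaB n (i + 1) * sigmaB n i)⁻¹ = sigmaB n i := by
      rw [← sigmaB_braid hbn]
      group
    have key := (Commute.conj_iff (sigmaB n (i + 1) * sigmaB n i)).2
      (sigmaB_commute_bandWord_of_disjoint (n := n) (i := i + 1) hai (Or.inr (Nat.lt_succ_self i)))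
    rw [hk] at key
    rw [bandWord_succ (by omega), bandWord_succ hai]
    simpa only [mul_assoc, mul_inv_rev] using key
  | succ b hib ih =>
    have hb : Commute (sigmaB n i) (sigmaB n b) := sigmaB_commute (by omega)
    rw [bandWord_succ (by omega)]
    exact (hb.mul_right (ih (by omega))).mul_right hb.inv_right

theorem bandWord_eq_conj {a b : ℕ} (hab : a + 1 < b) (hbn : b < n) :
    bandWord n a b = (sigmaB n a)⁻¹ * bandWord n (a + 1) b * sigmaB n a := by
  induction b, hab using Nat.le_induction with
  | base =>
    rw [bandWord_succ (Nat.lt_succ_self a), bandWord_self_succ, bandWord_self_succ,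
      mul_inv_eq_iff_eq_mul, mul_assoc, mul_assoc, eq_inv_mul_iff_mul_eq, ← mul_assoc, ← mul_assoc]
    exact sigmaB_braid hbn
  | succ b hab ih =>
    have hb : Commute (sigmaB n a) (sigmaB n b) := sigmaB_commute (by omega)
    rw [bandWord_succ (by omega), bandWord_succ (by omega), ih (by omega)]
    simp only [mul_assoc]
    rw [hb.inv_right.eq, ← mul_assoc, hb.symm.inv_right.eq, mul_assoc]

theorem sigmaB_bandWord_braid {r s : ℕ} (hrs : r < s) (hs : s + 1 < n) :
    sigmaB n s * bandWord n r s * sigmaB n s =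
      bandWord n r s * sigmaB n s * bandWord n r s := by
  induction hd : s - (r + 1) generalizing r with
  | zero =>
    obtain rfl : s = r + 1 := by omega
    rw [bandWord_self_succ, sigmaB_braid hs]
  | succ d ih =>
    have hc : Commute (sigmaB n r) (sigmaB n s) := sigmaB_commute (by omega)
    have ih := ih (r := r + 1) (by omega) (by omega)
    have hs' : sigmaB n s = (sigmaB n r)⁻¹ * sigmaB n s * sigmaB n r := by
      rw [mul_assoc, ← hc.eq, inv_mul_cancel_left]
    rw [bandWord_eq_conj (by omega) (by omega)]
    calc _ = (sigmaB n r)⁻¹ * sigmaB n s * sigmaB n r *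
          ((sigmaB n r)⁻¹ * bandWord n (r + 1) s * sigmaB n r) *
          ((sigmaB n r)⁻¹ * sigmaB n s * sigmaB n r) := by rw [← hs']
      _ = (sigmaB n r)⁻¹ * (sigmaB n s * bandWord n (r + 1) s * sigmaB n s) * sigmaB n r := by
        group
      _ = (sigmaB n r)⁻¹ * bandWord n (r + 1) s * sigmaB n r *
          ((sigmaB n r)⁻¹ * sigmaB n s * sigmaB n r) *
          ((sigmaB n r)⁻¹ * bandWord n (r + 1) s * sigmaB n r) := by
        rw [ih]
        group
      _ = _ := by rw [← hs']

theorem bandWord_triangle_left {r s t : ℕ} (hrs : r < s) (hst : s < t) :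
    bandWord n s t * bandWord n r s = bandWord n r t * bandWord n s t := by
  induction t, hst using Nat.le_induction with
  | base => rw [bandWord_self_succ, bandWord_succ hrs, inv_mul_cancel_right]
  | succ t hst ih =>
    have hc := (sigmaB_commute_bandWord_of_disjoint (n := n) hrs (Or.inr hst)).inv_left
    rw [bandWord_succ hst, bandWord_succ (hrs.trans hst), mul_assoc, hc.eq, ← mul_assoc,
      mul_assoc (sigmaB n t), ih]
    group

theorem bandWord_triangle_right {r s t : ℕ} (hrs : r < s) (hst : s < t) (ht : t < n) :
    bandWord n s t * bandWord n r s = bandWord n r s * bandWord n r t := by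
  induction t, hst using Nat.le_induction with
  | base =>
    rw [bandWord_self_succ, bandWord_succ hrs, ← mul_assoc, ← mul_assoc, eq_mul_inv_iff_mul_eq,
      sigmaB_bandWord_braid hrs ht]
  | succ t hst ih =>
    have hc := sigmaB_commute_bandWord_of_disjoint (n := n) hrs (Or.inr hst)
    rw [bandWord_succ hst, bandWord_succ (hrs.trans hst), mul_assoc, hc.inv_left.eq, ← mul_assoc,
      mul_assoc (sigmaB n t), ih (by omega), ← mul_assoc, hc.eq]
    simp only [mul_assoc]

theorem bandWord_commute {s t q r : ℕ} (hst : s < t) (hqr : q < r) (hr : r < n)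
    (h : t < q ∨ (q < s ∧ t < r)) : Commute (bandWord n s t) (bandWord n q r) := by
  refine (commute_bandWord_of_forall hst fun k hk hkt => ?_).symm
  rcases h with h | h
  · exact (sigmaB_commute_bandWord_of_disjoint hqr (Or.inl (by omega))).symm
  · exact (sigmaB_commute_bandWord_of_nested (by omega) (by omega) hr).symm

/-- The homomorphism from the Birman–Ko–Lee monoid to the braid group sending each generator to
the corresponding band word. -/
def bandHom (n : ℕ) : BKLMonoid n →* BraidGroup n :=
  (conGen (BKLMonoidRel n)).lift (FreeMonoid.lift fun p => bandWord n p.1.1 p.1.2) <|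
    Con.conGen_le.2 fun _ _ h => by
      rw [Con.ker_rel]
      induction h with
      | comm p q h =>
        rw [sign_condition_iff p.2 q.2] at h
        simp only [map_mul, FreeMonoid.lift_eval_of]
        have hp := p.2
        have hq := q.2
        rcases h with h | h | h | h
        · exact bandWord_commute hp hq q.1.2.2 (Or.inl h)
        · exact (bandWord_commute hq hp p.1.2.2 (Or.inl h)).symm
        · exact (bandWord_commute hq hp p.1.2.2 (Or.inr h)).symm
        · exact bandWord_commute hp hq q.1.2.2 (Or.inr h)
      | triangleA r s t hrs hst =>
        simp only [map_mul, FreeMonoid.lift_eval_of]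
        exact bandWord_triangle_left hrs hst
      | triangleB r s t hrs hst =>
        simp only [map_mul, FreeMonoid.lift_eval_of]
        exact bandWord_triangle_right hrs hst t.2

theorem bandHom_atom (p : BKLIdx n) : bandHom n (atom p) = bandWord n p.1.1 p.1.2 := rfl

/-- The generator `σ_{i,i+1}` of the Birman–Ko–Lee monoid. -/
def artinAtom (i : Fin (n - 1)) : BKLMonoid n :=
  atom ⟨(⟨i, by omega⟩, ⟨i + 1, by omega⟩), Nat.lt_succ_self i⟩

theorem artinAtom_comm {i k : Fin (n - 1)} (h : (i : ℕ) + 2 ≤ k) :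
    artinAtom i * artinAtom k = artinAtom k * artinAtom i :=
  atom_comm (Or.inl (Fin.lt_def.2 h))

theorem artinAtom_braid {i k : Fin (n - 1)} (h : (i : ℕ) + 1 = k) :
    artinAtom i * artinAtom k * artinAtom i = artinAtom k * artinAtom i * artinAtom k := by
  obtain ⟨k, hk⟩ := k
  obtain rfl : (i : ℕ) + 1 = k := h
  have hrs : (⟨i, by omega⟩ : Fin n) < ⟨i + 1, by omega⟩ := Nat.lt_succ_self i
  have hst : (⟨i + 1, by omega⟩ : Fin n) < ⟨i + 1 + 1, by omega⟩ := Nat.lt_succ_self _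
  have hl := atom_triangle_left hrs hst
  have hr := atom_triangle_right hrs hst
  unfold artinAtom
  rw [hr, mul_assoc, hr, mul_assoc, ← hl, hr]

/-- A homomorphism from the Birman–Ko–Lee monoid to a group induces one from the braid group. -/
def liftBraid {G : Type*} [Group G] (ι : BKLMonoid n →* G) : BraidGroup n →* G :=
  PresentedGroup.toGroup (f := fun i => ι (artinAtom i)) <| by
    rintro w (⟨i, k, h, rfl⟩ | ⟨i, k, h, rfl⟩)
    · simp only [map_mul, map_inv, FreeGroup.lift_apply_of]
      rw [mul_inv_eq_one, ← map_mul, artinAtom_comm h, map_mul]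
    · simp only [map_mul, map_inv, FreeGroup.lift_apply_of]
      rw [mul_inv_eq_one, ← map_mul, ← map_mul, artinAtom_braid h, map_mul, map_mul]

theorem liftBraid_sigmaB {G : Type*} [Group G] (ι : BKLMonoid n →* G) {i : ℕ}
    (h : i < n - 1) : liftBraid ι (sigmaB n i) = ι (artinAtom ⟨i, h⟩) := by
  rw [sigmaB, dif_pos h]
  exact PresentedGroup.toGroup.of _

theorem liftBraid_bandWord {G : Type*} [Group G] (ι : BKLMonoid n →* G) {s t : ℕ} (hst : s < t)
    (ht : t < n) : liftBraid ι (bandWord n s t) =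
      ι (atom ⟨(⟨s, hst.trans ht⟩, ⟨t, ht⟩), hst⟩) := by
  induction t, hst using Nat.le_induction with
  | base => rw [bandWord_self_succ, liftBraid_sigmaB ι (by omega)]; rfl
  | succ t hst ih =>
    rw [bandWord_succ hst, map_mul, map_mul, map_inv, ih (by omega), liftBraid_sigmaB ι (by omega),
      mul_inv_eq_iff_eq_mul, ← map_mul, ← map_mul]
    exact congrArg ι (atom_triangle_left (r := ⟨s, by omega⟩) (s := ⟨t, by omega⟩)
      (t := ⟨t + 1, ht⟩) hst (Nat.lt_succ_self t))

theorem liftBraid_bandHom {G : Type*} [Group G] (ι : BKLMonoid n →* G) (x : BKLMonoid n) :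
    liftBraid ι (bandHom n x) = ι x := by
  induction x using induction_on with
  | one => simp
  | atom_mul p x ih =>
    rw [map_mul, map_mul, map_mul, ih, bandHom_atom, liftBraid_bandWord ι p.2 p.1.2.2]

theorem bandHom_injective (n : ℕ) : Function.Injective (bandHom n) := by
  obtain ⟨G, _, ι, hι⟩ := exists_injective_hom_to_group n
  intro x y h
  apply hι
  rw [← liftBraid_bandHom, h, liftBraid_bandHom]

end BKL

/-- (Birman–Ko–Lee) The monoid homomorphism from `BKLₙ⁺` to the braid group `Bₙ`
sending each generator `σ_{s,t}` to the corresponding band word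
`(σ_{t-1} ⋯ σ_{s+1}) σ_s (σ_{s+1}⁻¹ ⋯ σ_{t-1}⁻¹)` is well defined and injective. -/
theorem bkl_monoid_embeds (n : ℕ) :
    ∃ f : BKLMonoid n →* BraidGroup n,
      (∀ (s t : Fin n) (h : s < t),
        f ((conGen (BKLMonoidRel n)).mk' (FreeMonoid.of ⟨(s, t), h⟩)) =
          bandWord n (s : ℕ) (t : ℕ)) ∧
      Function.Injective f := by
  exact ⟨BKL.bandHom n, fun s t h => BKL.bandHom_atom ⟨(s, t), h⟩, BKL.bandHom_injective n⟩
end
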